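/- arXiv:0907.0790 — 4 statements merged into one kernel-verified Lean document; each statement's English description precedes it below -/
import Mathlib

section
/- If ∑_{m,n≥0} a(m,n) x^m y^n is the Taylor expansion of a rational function, then for any fixed positive integers r₁, r₂ the series ∑_{m,n≥0} a(r₁m, r₂n) x^m y^n is also the Taylor expansion of a rational function. -/
/-- A bivariate sequence of coefficients is the Taylor series of a rational function
(with denominator non-vanishing at the origin). -/
def IsRationalBivariateSeries (a : ℕ → ℕ → ℂ) : Prop :=
  ∃ p q : MvPolynomial (Fin 2) ℂ, MvPolynomial.eval (fun _ => (0 : ℂ)) q ≠ 0 ∧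
    ∃ ε > (0 : ℝ), ∀ x y : ℂ, ‖x‖ < ε → ‖y‖ < ε →
      HasSum (fun mn : ℕ × ℕ => a mn.1 mn.2 * x ^ mn.1 * y ^ mn.2)
        (MvPolynomial.eval ![x, y] p / MvPolynomial.eval ![x, y] q)

noncomputable instance rsd_fintype (r : ℕ) [NeZero r] : Fintype (rootsOfUnity r ℂ) :=
  Fintype.ofFinite _

lemma rsd_card (r : ℕ) [NeZero r] : Fintype.card (rootsOfUnity r ℂ) = r := by
  rw [← Nat.card_eq_fintype_card, Complex.card_rootsOfUnity]

open MvPolynomial in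
lemma rsd_tw (c d : ℂ) (q : MvPolynomial (Fin 2) ℂ) : ∃ q' : MvPolynomial (Fin 2) ℂ,
    ∀ x y : ℂ, eval ![x, y] q' = eval ![c * x, d * y] q := by
  refine ⟨bind₁ ![C c * X 0, C d * X 1] q, fun x y => ?_⟩
  rw [← MvPolynomial.coe_aeval_eq_eval, ← MvPolynomial.coe_aeval_eq_eval]
  simp only [RingHom.coe_coe]
  rw [aeval_bind₁]
  congr 2
  funext i
  fin_cases i <;> simp

lemma rsd_sum (r : ℕ) [NeZero r] (m : ℕ) :
    ∑ g : rootsOfUnity r ℂ, (((g : ℂˣ) : ℂ)) ^ m = if r ∣ m then (r : ℂ) else 0 := by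
  split_ifs with h
  · obtain ⟨k, rfl⟩ := h
    have : ∀ g : rootsOfUnity r ℂ, (((g : ℂˣ) : ℂ)) ^ (r * k) = 1 := by
      intro g
      have h := g.2
      rw [mem_rootsOfUnity'] at h
      rw [pow_mul, h, one_pow]
    simp only [this]
    rw [Finset.sum_const, Finset.card_univ, rsd_card]
    simp
  · have hp := Complex.isPrimitiveRoot_exp r (NeZero.ne r)
    set z := Complex.exp (2 * Real.pi * Complex.I / r) with hz
    have hz1 : z ^ m ≠ 1 := fun hh => h (hp.dvd_of_pow_eq_one m hh)
    let w : rootsOfUnity r ℂ := hp.toRootsOfUnity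
    have hw : ((w : ℂˣ) : ℂ) = z := by simp [w]
    have key : ∑ g : rootsOfUnity r ℂ, (((g : ℂˣ) : ℂ)) ^ m
        = z ^ m * ∑ g : rootsOfUnity r ℂ, (((g : ℂˣ) : ℂ)) ^ m := by
      rw [Finset.mul_sum, ← Equiv.sum_comp (Equiv.mulLeft w)]
      refine Finset.sum_congr rfl fun g _ => ?_
      simp [hw, mul_pow]
    have : (1 - z ^ m) * ∑ g : rootsOfUnity r ℂ, (((g : ℂˣ) : ℂ)) ^ m = 0 := by
      linear_combination key
    rcases mul_eq_zero.1 this with h' | h'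
    · exact absurd (by linear_combination -h') hz1
    · exact h'

lemma rsd_sum2 (r₁ r₂ : ℕ) [NeZero r₁] [NeZero r₂] (m n : ℕ) (A x y : ℂ) :
    ∑ g : rootsOfUnity r₁ ℂ × rootsOfUnity r₂ ℂ,
      A * (((g.1 : ℂˣ) : ℂ) * x) ^ m * (((g.2 : ℂˣ) : ℂ) * y) ^ n
      = A * x ^ m * y ^ n * ((if r₁ ∣ m then (r₁ : ℂ) else 0) * (if r₂ ∣ n then (r₂ : ℂ) else 0)) := by
  rw [← rsd_sum, ← rsd_sum, Finset.sum_mul_sum, Fintype.sum_prod_type, Finset.mul_sum]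
  refine Finset.sum_congr rfl fun g _ => ?_
  rw [Finset.mul_sum]
  refine Finset.sum_congr rfl fun h _ => ?_
  ring

open MvPolynomial in
lemma rsd_avg (r₁ r₂ : ℕ) [NeZero r₁] [NeZero r₂] (P : MvPolynomial (Fin 2) ℂ) :
    ∃ P' : MvPolynomial (Fin 2) ℂ, ∀ x y : ℂ, eval ![x ^ r₁, y ^ r₂] P' =
      ∑ g : rootsOfUnity r₁ ℂ × rootsOfUnity r₂ ℂ,
        eval ![((g.1 : ℂˣ) : ℂ) * x, ((g.2 : ℂˣ) : ℂ) * y] P := by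
  induction P using MvPolynomial.induction_on' with
  | monomial u A =>
    have e : ∀ x y : ℂ, eval ![x, y] (monomial u A) = A * x ^ (u 0) * y ^ (u 1) := by
      intro x y
      rw [eval_monomial, Finsupp.prod_fintype _ _ (by simp)]
      simp [Fin.prod_univ_two, mul_assoc]
    simp only [e, rsd_sum2]
    by_cases h1 : r₁ ∣ u 0
    · by_cases h2 : r₂ ∣ u 1
      · obtain ⟨k, hk⟩ := h1
        obtain ⟨l, hl⟩ := h2
        refine ⟨C (A * (r₁ * r₂)) * X 0 ^ k * X 1 ^ l, fun x y => ?_⟩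
        simp [hk, hl, pow_mul]
        ring
      · exact ⟨0, by simp [h2]⟩
    · exact ⟨0, by simp [h1]⟩
  | add p q hp hq =>
    obtain ⟨p', hp⟩ := hp
    obtain ⟨q', hq⟩ := hq
    exact ⟨p' + q', fun x y => by simp [hp, hq, Finset.sum_add_distrib]⟩

open MvPolynomial in
theorem rational_series_dilation (a : ℕ → ℕ → ℂ) (ha : IsRationalBivariateSeries a)
    (r₁ r₂ : ℕ) (hr₁ : 0 < r₁) (hr₂ : 0 < r₂) :
    IsRationalBivariateSeries (fun m n => a (r₁ * m) (r₂ * n)) := by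
  classical
  obtain ⟨p, q, hq0, ε, hε, hs⟩ := ha
  have : NeZero r₁ := ⟨hr₁.ne'⟩
  have : NeZero r₂ := ⟨hr₂.ne'⟩
  have hr1 : (r₁ : ℂ) ≠ 0 := by exact_mod_cast hr₁.ne'
  have hr2 : (r₂ : ℂ) ≠ 0 := by exact_mod_cast hr₂.ne'
  have h00 : (fun _ => (0 : ℂ)) = (![0, 0] : Fin 2 → ℂ) := by
    funext i; fin_cases i <;> rfl
  rw [h00] at hq0
  -- nonvanishing
  obtain ⟨δ, hδ, hqδ⟩ : ∃ δ > (0 : ℝ), ∀ x y : ℂ, ‖x‖ < δ → ‖y‖ < δ → eval ![x, y] q ≠ 0 := by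
    have hc : Continuous fun v : Fin 2 → ℂ => eval v q := MvPolynomial.continuous_eval q
    have ho := (hc.isOpen_preimage _ (isOpen_compl_singleton (x := (0 : ℂ))))
    obtain ⟨δ, hδ, hb⟩ := Metric.isOpen_iff.1 ho ![0, 0] hq0
    refine ⟨δ, hδ, fun x y hx hy => hb ?_⟩
    rw [Metric.mem_ball, dist_pi_lt_iff hδ]
    intro i
    fin_cases i <;> simpa
  let G := rootsOfUnity r₁ ℂ × rootsOfUnity r₂ ℂ
  choose T hT using fun g : G => rsd_tw ((g.1 : ℂˣ) : ℂ) ((g.2 : ℂˣ) : ℂ) q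
  have hn1 : ∀ g : rootsOfUnity r₁ ℂ, ‖((g : ℂˣ) : ℂ)‖ = 1 := fun g =>
    Complex.norm_eq_one_of_mem_rootsOfUnity g.2
  have hn2 : ∀ g : rootsOfUnity r₂ ℂ, ‖((g : ℂˣ) : ℂ)‖ = 1 := fun g =>
    Complex.norm_eq_one_of_mem_rootsOfUnity g.2
  let Q := ∏ g : G, T g
  let H := p * ∏ g ∈ (Finset.univ : Finset G).erase 1, T g
  have hT1 : ∀ x y, eval ![x, y] (T 1) = eval ![x, y] q := by
    intro x y; rw [hT]; simp
  have hQ : ∀ x y, eval ![x, y] Q = ∏ g : G, eval ![((g.1 : ℂˣ) : ℂ) * x, ((g.2 : ℂˣ) : ℂ) * y] q := by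
    intro x y; simp only [Q, map_prod, hT]
  have hQinv : ∀ (h : G) x y, eval ![((h.1 : ℂˣ) : ℂ) * x, ((h.2 : ℂˣ) : ℂ) * y] Q
      = eval ![x, y] Q := by
    intro h x y
    rw [hQ, hQ]
    refine Fintype.prod_equiv (Equiv.mulRight h) _ _ fun g => ?_
    change _ = eval ![(((g.1 * h.1 : rootsOfUnity r₁ ℂ) : ℂˣ) : ℂ) * x,
      (((g.2 * h.2 : rootsOfUnity r₂ ℂ) : ℂˣ) : ℂ) * y] q
    simp [mul_assoc]
  have hQne : ∀ x y : ℂ, ‖x‖ < δ → ‖y‖ < δ → eval ![x, y] Q ≠ 0 := by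
    intro x y hx hy
    rw [hQ, Finset.prod_ne_zero_iff]
    intro g _
    apply hqδ <;> simpa [hn1, hn2]
  have hf : ∀ x y : ℂ, ‖x‖ < δ → ‖y‖ < δ →
      eval ![x, y] p / eval ![x, y] q = eval ![x, y] H / eval ![x, y] Q := by
    intro x y hx hy
    have hq := hqδ x y hx hy
    have hQ' := hQne x y hx hy
    rw [div_eq_div_iff hq hQ']
    have : Q = T 1 * ∏ g ∈ (Finset.univ : Finset G).erase 1, T g :=
      (Finset.mul_prod_erase _ _ (Finset.mem_univ _)).symm
    rw [this]
    simp only [H, map_mul, hT1]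
    ring
  obtain ⟨H', hH'⟩ := rsd_avg r₁ r₂ H
  obtain ⟨Q', hQ'⟩ := rsd_avg r₁ r₂ Q
  have hQ'' : ∀ x y : ℂ, eval ![x ^ r₁, y ^ r₂] Q' = (r₁ * r₂ : ℂ) * eval ![x, y] Q := by
    intro x y
    rw [hQ', Finset.sum_congr rfl fun g _ => hQinv g x y]
    rw [Finset.sum_const, Finset.card_univ, Fintype.card_prod, rsd_card, rsd_card]
    simp
  refine ⟨H', Q', ?_, min ((min ε δ) ^ r₁) ((min ε δ) ^ r₂), by positivity, ?_⟩
  · rw [h00]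
    have := hQ'' 0 0
    rw [zero_pow hr₁.ne', zero_pow hr₂.ne'] at this
    rw [this]
    exact mul_ne_zero (mul_ne_zero hr1 hr2) (hQne 0 0 (by simpa) (by simpa))
  intro X Y hX hY
  obtain ⟨x, rfl⟩ := IsAlgClosed.exists_pow_nat_eq X hr₁
  obtain ⟨y, rfl⟩ := IsAlgClosed.exists_pow_nat_eq Y hr₂
  have hm : 0 ≤ min ε δ := by positivity
  have hx : ‖x‖ < min ε δ := by
    rw [norm_pow] at hX
    exact lt_of_pow_lt_pow_left₀ r₁ hm (hX.trans_le (min_le_left _ _))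
  have hy : ‖y‖ < min ε δ := by
    rw [norm_pow] at hY
    exact lt_of_pow_lt_pow_left₀ r₂ hm (hY.trans_le (min_le_right _ _))
  obtain ⟨hxε, hxδ⟩ := lt_min_iff.1 hx
  obtain ⟨hyε, hyδ⟩ := lt_min_iff.1 hy
  have hS := hasSum_sum (s := (Finset.univ : Finset G)) fun g _ =>
    hs (((g.1 : ℂˣ) : ℂ) * x) (((g.2 : ℂˣ) : ℂ) * y) (by simpa [hn1]) (by simpa [hn2])
  have hval : ∑ g : G, eval ![((g.1 : ℂˣ) : ℂ) * x, ((g.2 : ℂˣ) : ℂ) * y] p /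
      eval ![((g.1 : ℂˣ) : ℂ) * x, ((g.2 : ℂˣ) : ℂ) * y] q
      = eval ![x ^ r₁, y ^ r₂] H' / eval ![x, y] Q := by
    rw [hH', Finset.sum_div]
    refine Finset.sum_congr rfl fun g _ => ?_
    rw [hf _ _ (by simpa [hn1]) (by simpa [hn2]), hQinv]
  rw [hval] at hS
  have hS2 : HasSum (fun mn : ℕ × ℕ => a mn.1 mn.2 * x ^ mn.1 * y ^ mn.2 *
      ((if r₁ ∣ mn.1 then (r₁ : ℂ) else 0) * (if r₂ ∣ mn.2 then (r₂ : ℂ) else 0)))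
      (eval ![x ^ r₁, y ^ r₂] H' / eval ![x, y] Q) := by
    convert hS using 1
    funext mn
    rw [← rsd_sum2]
  have hinj : Function.Injective (fun mn : ℕ × ℕ => (r₁ * mn.1, r₂ * mn.2)) := by
    rintro ⟨m, n⟩ ⟨m', n'⟩ h
    simpa [hr₁.ne', hr₂.ne'] using h
  rw [← hinj.hasSum_iff] at hS2
  · have hS3 := hS2.div_const (r₁ * r₂ : ℂ)
    rw [hQ'']
    rw [div_div, mul_comm (eval ![x, y] Q)] at hS3
    refine Eq.mp (congrArg (fun f => HasSum f _) (funext fun mn => ?_)) hS3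
    simp [pow_mul]
    field_simp
  · rintro ⟨m, n⟩ hmn
    by_cases h1 : r₁ ∣ m
    · by_cases h2 : r₂ ∣ n
      · obtain ⟨k, rfl⟩ := h1
        obtain ⟨l, rfl⟩ := h2
        exact absurd ⟨(k, l), rfl⟩ hmn
      · simp [h2]
    · simp [h1]
end

section
/- If f(x₁,x₂) = ∑_{m,n≥0} a_{m,n} x₁^m x₂^n is the Taylor series at the origin of a rational function p/q with q(0,0) ≠ 0, then for every pair of coprime positive integers (δ₁,δ₂) the diagonal series f_δ(t) = ∑_{r≥0} a_{δ₁r, δ₂r} t^r defines an algebraic function of t. -/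
/-- A function of one complex variable is algebraic near the origin: it satisfies a
nonzero polynomial equation with polynomial coefficients. -/
def IsAlgebraicFn (g : ℂ → ℂ) : Prop :=
  ∃ P : Polynomial (Polynomial ℂ), P ≠ 0 ∧
    ∃ ε > (0 : ℝ), ∀ t : ℂ, ‖t‖ < ε →
      (P.map (Polynomial.evalRingHom t)).eval (g t) = 0

open Polynomial

noncomputable def phip : (PowerSeries ℂ)[X] →+* PowerSeries ℂ[X] :=
  eval₂RingHom (PowerSeries.map Polynomial.C) (PowerSeries.C X)
noncomputable def iop : PowerSeries ℂ[X] →+* PowerSeries (LaurentPolynomial ℂ) :=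
  PowerSeries.map Polynomial.toLaurent
noncomputable def iom : PowerSeries ℂ[X] →+* PowerSeries (LaurentPolynomial ℂ) :=
  PowerSeries.map ((LaurentPolynomial.invert : LaurentPolynomial ℂ ≃ₐ[ℂ] _).toRingEquiv.toRingHom.comp Polynomial.toLaurent)
noncomputable def CT (w : PowerSeries (LaurentPolynomial ℂ)) : PowerSeries ℂ :=
  PowerSeries.mk fun n => (PowerSeries.coeff n w).coeff 0

lemma CT_add (v w) : CT (v + w) = CT v + CT w := by
  ext n; simp [CT]

lemma toLaurent_coeff_zero (p : ℂ[X]) : (Polynomial.toLaurent p).coeff 0 = p.eval 0 := by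
  induction p using Polynomial.induction_on' with
  | add p q hp hq => rw [map_add, AddMonoidAlgebra.coeff_add, Finsupp.add_apply, hp, hq, eval_add]
  | monomial n a =>
    rw [← Polynomial.C_mul_X_pow_eq_monomial, Polynomial.toLaurent_C_mul_X_pow,
      ← LaurentPolynomial.single_eq_C_mul_T]
    by_cases h : n = 0
    · subst h; simp
    · rw [AddMonoidAlgebra.coeff_single, Finsupp.single_apply, if_neg (by exact_mod_cast h)]
      simp [h]

lemma CT_iop (p) : CT (iop p) = PowerSeries.map (evalRingHom 0) p := by
  ext n
  simp only [CT, iop, PowerSeries.coeff_mk, PowerSeries.coeff_map, toLaurent_coeff_zero, coe_evalRingHom]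

lemma CT_iom (p) : CT (iom p) = PowerSeries.map (evalRingHom 0) p := by
  rw [← CT_iop]
  ext n; simp [CT, iop, iom]

lemma CT_mul (r : PowerSeries ℂ) (w) :
    CT (PowerSeries.map LaurentPolynomial.C r * w) = r * CT w := by
  ext n
  simp only [CT, PowerSeries.coeff_mul, PowerSeries.coeff_mk, PowerSeries.coeff_map,
    AddMonoidAlgebra.coeff_sum, Finsupp.finsetSum_apply]
  refine Finset.sum_congr rfl fun x _ => ?_
  rw [← LaurentPolynomial.smul_eq_C_mul]
  simp

lemma constantCoeff_phip (p) : PowerSeries.constantCoeff (phip p) = p.map (PowerSeries.constantCoeff) := by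
  have : (PowerSeries.constantCoeff).comp phip = mapRingHom (PowerSeries.constantCoeff (R := ℂ)) := by
    refine Polynomial.ringHom_ext (fun a => ?_) ?_
    · simp only [phip, RingHom.comp_apply, coe_eval₂RingHom, eval₂_C, coe_mapRingHom, map_C]
      rw [← PowerSeries.coeff_zero_eq_constantCoeff_apply,
        ← PowerSeries.coeff_zero_eq_constantCoeff_apply, PowerSeries.coeff_map]
    · simp [phip]
  exact congr($this p)
lemma map_phip (p) : PowerSeries.map (evalRingHom 0) (phip p) = p.eval 0 := by
  have : (PowerSeries.map (evalRingHom 0)).comp phip = evalRingHom 0 := by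
    ext <;> simp [phip]
  exact congr($this p)

lemma phip_reflect (M : ℕ) (p : (PowerSeries ℂ)[X]) (hp : p.natDegree ≤ M) :
    iop (phip p) = PowerSeries.C (LaurentPolynomial.T M) * iom (phip (reflect M p)) := by
  refine Polynomial.induction_with_natDegree_le (fun p => 
    iop (phip p) = PowerSeries.C (LaurentPolynomial.T M) * iom (phip (reflect M p))) M
    (by simp) ?_ ?_ p hp
  · intro n r hr hn 
    rw [reflect_C_mul_X_pow]
    have h1 : iom (PowerSeries.map Polynomial.C r) = iop (PowerSeries.map Polynomial.C r) := by
      ext; simp [iom, iop]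
    simp only [phip, Polynomial.revAt_le hn, coe_eval₂RingHom, eval₂_C, eval₂_X_pow, map_mul, h1]
    rw [mul_left_comm]
    congr 1
    simp only [iop, iom, map_pow, PowerSeries.map_C]
    simp only [← map_pow, ← map_mul]
    congr 1
    rw [map_pow, map_pow, toLaurent_X, LaurentPolynomial.T_pow]
    simp only [RingHom.comp_apply, toLaurent_X]
    have : ((LaurentPolynomial.invert : LaurentPolynomial ℂ ≃ₐ[ℂ] _).toRingEquiv.toRingHom (LaurentPolynomial.T 1)) = LaurentPolynomial.T (-1) := LaurentPolynomial.invert_T 1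
    rw [this, LaurentPolynomial.T_pow, ← LaurentPolynomial.T_add]
    congr 1
    push_cast [hn]
    ring
  · intro f g h1 h2 h3 h4 
    simp only [reflect_add, map_add, h3, h4, mul_add]

/-- const term lemma -/
lemma CT_alg (A B E D P : (PowerSeries ℂ)[X]) (r : PowerSeries ℂ) (M : ℕ) (b : ℂ) (hb : b ≠ 0)
    (hAd : A.natDegree ≤ M) (hA : A.map PowerSeries.constantCoeff = X ^ M)
    (hB : B.map PowerSeries.constantCoeff = C b) (hD : D.degree < M)
    (h : C r * P = A * E + B * D) (w : PowerSeries (LaurentPolynomial ℂ))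
    (hw : iop (phip (A * B)) * w = iop (phip P)) :
    B.eval 0 * (r * CT w) = E.eval 0 := by
  have hBu : IsUnit (phip B) := by
    rw [PowerSeries.isUnit_iff_constantCoeff, constantCoeff_phip, hB]
    exact Polynomial.isUnit_C.mpr hb.isUnit
  have hAu : IsUnit (phip (reflect M A)) := by
    rw [PowerSeries.isUnit_iff_constantCoeff, constantCoeff_phip, ← Polynomial.reflect_map, hA]
    simp [reflect_monomial, revAt_le]
  obtain ⟨B', hB'⟩ := hBu.exists_right_inv
  obtain ⟨A', hA'⟩ := hAu.exists_right_inv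
  have hDd : D.natDegree ≤ M := natDegree_le_of_degree_le hD.le
  have key : PowerSeries.map LaurentPolynomial.C r * w =
      iop (phip E * B') + iom (phip (reflect M D) * A') := by
    have hr : iop (phip (C r)) = PowerSeries.map LaurentPolynomial.C r := by
      ext; simp [iop, phip]
    have hu : IsUnit (iop (phip (A * B))) := by
      rw [map_mul, map_mul, phip_reflect M A hAd]
      refine ((IsUnit.map _ ?_).mul (hAu.map _)).mul (hBu.map _)
      exact LaurentPolynomial.isUnit_T _
    refine hu.mul_left_cancel ?_
    rw [mul_left_comm, hw, ← hr, ← map_mul, ← map_mul, h]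
    simp only [map_add, map_mul]
    rw [phip_reflect M A hAd, phip_reflect M D hDd]
    have e1 : iop (phip B) * iop B' = 1 := by rw [← map_mul, hB', map_one]
    have e2 : iom (phip (reflect M A)) * iom A' = 1 := by rw [← map_mul, hA', map_one]
    linear_combination (-(PowerSeries.C (LaurentPolynomial.T (M:ℤ)) * iom (phip (reflect M A)) * iop (phip E))) * e1 - (PowerSeries.C (LaurentPolynomial.T (M:ℤ)) * iom (phip (reflect M D)) * iop (phip B)) * e2
  rw [← CT_mul, key, CT_add, CT_iop, CT_iom]
  simp only [map_mul, map_phip]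
  have e3 : (reflect M D).eval 0 = 0 := by
    rw [← coeff_zero_eq_eval_zero, coeff_reflect, revAt_le (Nat.zero_le _)]
    exact coeff_eq_zero_of_degree_lt (by simpa using hD)
  have e4 : B.eval 0 * PowerSeries.map (evalRingHom 0) B' = 1 := by
    rw [← map_phip, ← map_mul, hB', map_one]
  rw [e3]
  linear_combination (E.eval 0) * e4

lemma alg_coeff_of_dvd {T R : Type*} [CommRing T] [IsDomain T] [CommRing R] [IsDomain R]
    [Algebra T R] [FaithfulSMul T R] (Q : T[X]) (hQ : Q ≠ 0) (f : R[X]) (hf : f.Monic)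
    (hd : f ∣ Q.map (algebraMap T R)) (i : ℕ) : IsAlgebraic T (f.coeff i) := by
  let K := FractionRing R
  let F := FractionRing T
  have : FaithfulSMul T K := FaithfulSMul.trans T R K
  let _ : Algebra F K := FractionRing.liftAlgebra T K
  have : IsScalarTower T F K := FractionRing.isScalarTower_liftAlgebra T K
  have hinj : Function.Injective (algebraMap R K) := IsFractionRing.injective R K
  rw [← isAlgebraic_algebraMap_iff hinj, IsFractionRing.isAlgebraic_iff T F K]
  let q : F[X] := Q.map (algebraMap T F)
  have hq : q ≠ 0 := (Polynomial.map_ne_zero_iff (IsFractionRing.injective T F)).mpr hQ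
  have hm := monic_mul_leadingCoeff_inv hq
  have := integralClosure.mem_lifts_of_monic_of_dvd_map K hm (hf.map (algebraMap R K)) ?_
  · rw [lifts_iff_coeff_lifts] at this
    obtain ⟨y, hy⟩ := this i
    rw [coeff_map] at hy
    rw [← hy]
    exact IsIntegral.isAlgebraic y.2
  · rw [Polynomial.map_mul]
    refine Dvd.dvd.mul_right ?_ _
    have := Polynomial.map_dvd (algebraMap R K) hd
    rwa [Polynomial.map_map, ← IsScalarTower.algebraMap_eq, IsScalarTower.algebraMap_eq T F K, ← Polynomial.map_map] at this

noncomputable abbrev SS : Subalgebra ℂ[X] (PowerSeries ℂ) := Subalgebra.algebraicClosure ℂ[X] (PowerSeries ℂ)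
noncomputable def epsS : SS →+* ℂ := PowerSeries.constantCoeff.comp (algebraMap SS (PowerSeries ℂ))

lemma eps_alg : (PowerSeries.constantCoeff).comp (algebraMap ℂ[X] (PowerSeries ℂ)) = evalRingHom 0 := by
  ext <;> simp [PowerSeries.algebraMap_apply']

lemma eps_alg' : epsS.comp (algebraMap ℂ[X] SS) = evalRingHom 0 := by
  rw [← eps_alg, epsS, RingHom.comp_assoc, ← IsScalarTower.algebraMap_eq]

lemma alg_inj : Function.Injective (algebraMap ℂ[X] (PowerSeries ℂ)) := by
  intro a b h
  simpa [PowerSeries.algebraMap_apply'] using h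

instance : FaithfulSMul ℂ[X] (PowerSeries ℂ) := (faithfulSMul_iff_algebraMap_injective _ _).mpr alg_inj

lemma dvd_of_dvd_coe {A : Type*} [CommRing A] (I : Ideal A) [IsAdicComplete I A] (f Q : A[X])
    (hD : f.IsDistinguishedAt I) (h : (f : PowerSeries A) ∣ (Q : PowerSeries A)) : f ∣ Q := by
  rw [← Ideal.mem_span_singleton, ← Ideal.Quotient.eq_zero_iff_mem]
  apply hD.algEquivQuotient.injective
  rw [map_zero, Polynomial.IsDistinguishedAt.algEquivQuotient_apply]
  erw [Ideal.quotientMap_mk]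
  rw [Ideal.Quotient.eq_zero_iff_mem, Ideal.mem_span_singleton]
  · simpa using h
  · rw [Ideal.span_le, Set.singleton_subset_iff, SetLike.mem_coe, Ideal.mem_comap, Ideal.mem_span_singleton]
    simp

lemma bez_aux {S : Type*} [CommRing S] (A B x y P : S[X]) (r : S) (hxy : A * x + B * y = C r) :
    C r * P = A * (x * P + B * ((y * P) /ₘ A)) + B * ((y * P) %ₘ A) := by
  have h1 := modByMonic_add_div (y * P) A
  rw [← hxy]
  linear_combination (-B) * h1

lemma factor0 (Q : ℂ[X][X]) (M : ℕ) (b : ℂ) (hb : b ≠ 0)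
    (hQ : Q.map (evalRingHom 0) = C b * X ^ M) :
    ∃ f : (PowerSeries ℂ)[X], f.Monic ∧ f.natDegree = M ∧ f.map PowerSeries.constantCoeff = X ^ M ∧
      f ∣ Q.map (algebraMap ℂ[X] (PowerSeries ℂ)) := by
  set Q1 := Q.map (algebraMap ℂ[X] (PowerSeries ℂ)) with hQ1
  have hQ1c : Q1.map PowerSeries.constantCoeff = C b * X ^ M := by
    rw [hQ1, Polynomial.map_map, eps_alg, hQ]
  have : IsAdicComplete (IsLocalRing.maximalIdeal (PowerSeries ℂ)) (PowerSeries ℂ) := by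
    rw [PowerSeries.maximalIdeal_eq_span_X]; infer_instance
  have hmem : ∀ x : PowerSeries ℂ, IsLocalRing.residue _ x = 0 ↔ PowerSeries.constantCoeff x = 0 := by
    intro x
    rw [IsLocalRing.residue_eq_zero_iff, PowerSeries.maximalIdeal_eq_span_X, Ideal.mem_span_singleton,
      PowerSeries.X_dvd_iff]
  have hc : ∀ i, PowerSeries.constantCoeff (Q1.coeff i) = if i = M then b else 0 := by
    intro i
    rw [← coeff_map, hQ1c, coeff_C_mul_X_pow]
  have hord : ((PowerSeries.map (IsLocalRing.residue (PowerSeries ℂ))) (Q1 : PowerSeries (PowerSeries ℂ))).order = M := by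
    rw [PowerSeries.order_eq_nat]
    constructor
    · rw [PowerSeries.coeff_map, Polynomial.coeff_coe, Ne, hmem, hc]; simpa
    · intro i hi
      rw [PowerSeries.coeff_map, Polynomial.coeff_coe, hmem, hc, if_neg hi.ne]
  obtain ⟨f, h, H⟩ := PowerSeries.exists_isWeierstrassFactorization
    (g := (Q1 : PowerSeries (PowerSeries ℂ))) (by
      intro h0
      rw [h0] at hord
      simp at hord)
  have hdeg : f.natDegree = M := by
    rw [H.natDegree_eq_toNat_order_map, hord]; rfl
  have hD := H.isDistinguishedAt
  refine ⟨f, hD.monic, hdeg, ?_, ?_⟩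
  · ext i
    rw [coeff_map, coeff_X_pow]
    rcases lt_trichotomy i M with hi | hi | hi
    · rw [if_neg hi.ne, ← hmem, IsLocalRing.residue_eq_zero_iff]
      exact hD.mem (hdeg ▸ hi)
    · rw [if_pos hi, hi, ← hdeg, hD.monic.coeff_natDegree, map_one]
    · rw [if_neg hi.ne', coeff_eq_zero_of_natDegree_lt (hdeg ▸ hi), map_zero]
  · exact dvd_of_dvd_coe _ f Q1 hD (Dvd.intro _ H.eq_mul.symm)

lemma factorS (Q : ℂ[X][X]) (M : ℕ) (b : ℂ) (hb : b ≠ 0)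
    (hQ : Q.map (evalRingHom 0) = C b * X ^ M) :
    ∃ A B : SS[X], A.Monic ∧ A.natDegree = M ∧ A.map epsS = X ^ M ∧ B.map epsS = C b ∧
      A * B = Q.map (algebraMap ℂ[X] SS) := by
  obtain ⟨f, hf, hfd, hf0, hfQ⟩ := factor0 Q M b hb hQ
  have hQ0 : Q ≠ 0 := by
    rintro rfl
    simp at hQ
    exact hb hQ
  have hl : f ∈ lifts (algebraMap SS (PowerSeries ℂ)) := by
    rw [lifts_iff_coeff_lifts]
    intro i
    exact ⟨⟨f.coeff i, alg_coeff_of_dvd Q hQ0 f hf hfQ i⟩, rfl⟩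
  obtain ⟨A, hA, hAd, hAm⟩ := lifts_and_natDegree_eq_and_monic hl hf
  have hinj : Function.Injective (algebraMap SS (PowerSeries ℂ)) := Subtype.val_injective
  have hA0 : A.map epsS = X ^ M := by
    rw [epsS, ← Polynomial.map_map, hA, hf0]
  have hprod : A * (Q.map (algebraMap ℂ[X] SS) /ₘ A) = Q.map (algebraMap ℂ[X] SS) := by
    have h1 := modByMonic_add_div (Q.map (algebraMap ℂ[X] SS)) A
    have h2 : Q.map (algebraMap ℂ[X] SS) %ₘ A = 0 := by
      apply Polynomial.map_injective _ hinj
      rw [map_modByMonic _ hAm, hA, Polynomial.map_map, ← IsScalarTower.algebraMap_eq, Polynomial.map_zero]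
      exact (modByMonic_eq_zero_iff_dvd hf).mpr hfQ
    rwa [h2, zero_add] at h1
  refine ⟨A, Q.map (algebraMap ℂ[X] SS) /ₘ A, hAm, hAd.trans hfd, hA0, ?_, hprod⟩
  have h3 := congrArg (Polynomial.map epsS) hprod
  rw [Polynomial.map_mul, hA0, Polynomial.map_map, eps_alg', hQ, mul_comm] at h3
  exact mul_right_cancel₀ (pow_ne_zero _ X_ne_zero) h3

lemma CT_algebraic (Q P : ℂ[X][X]) (M : ℕ) (b : ℂ) (hb : b ≠ 0)
    (hQ : Q.map (evalRingHom 0) = C b * X ^ M) (w : PowerSeries (LaurentPolynomial ℂ))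
    (hw : iop (phip (Q.map (algebraMap ℂ[X] (PowerSeries ℂ)))) * w =
      iop (phip (P.map (algebraMap ℂ[X] (PowerSeries ℂ))))) :
    IsAlgebraic ℂ[X] (CT w) := by
  obtain ⟨A, B, hAm, hAd, hA0, hB0, hAB⟩ := factorS Q M b hb hQ
  obtain ⟨x, y, -, -, hxy⟩ := exists_mul_add_mul_eq_C_resultant (m := M) (n := B.natDegree + 1) A B
    hAd.le (Nat.le_succ _) (Or.inr (Nat.succ_ne_zero _))
  set r := A.resultant B M (B.natDegree + 1) with hr
  have hr0 : epsS r ≠ 0 := by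
    rw [hr, ← resultant_map_map, hA0, hB0, resultant_C_right]
    simp [hb]
  let P' := P.map (algebraMap ℂ[X] SS)
  let D := (y * P') %ₘ A
  let E := x * P' + B * ((y * P') /ₘ A)
  have hD : D.degree < M := by
    have := degree_modByMonic_lt (y * P') hAm
    rwa [degree_eq_natDegree hAm.ne_zero, hAd] at this
  have hbez : C r * P' = A * E + B * D := by
    exact bez_aux A B x y P' r hxy
  let j := algebraMap SS (PowerSeries ℂ)
  have hfin := CT_alg (A.map j) (B.map j) (E.map j) (D.map j) (P'.map j) (j r) M b hb
    ((natDegree_map_le).trans hAd.le) (by rw [Polynomial.map_map]; exact hA0)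
    (by rw [Polynomial.map_map]; exact hB0) (degree_map_le.trans_lt hD)
    (by rw [← map_C, ← Polynomial.map_mul, hbez, Polynomial.map_add, Polynomial.map_mul, Polynomial.map_mul]) w
    (by
      rw [← Polynomial.map_mul, hAB, Polynomial.map_map, Polynomial.map_map]
      exact hw)
  have hev : ∀ p : SS[X], (p.map j).eval 0 = j (p.eval 0) := by
    intro p
    rw [← coeff_zero_eq_eval_zero, ← coeff_zero_eq_eval_zero, coeff_map]
  rw [hev, hev, ← mul_assoc, ← map_mul] at hfin
  have hne : epsS (B.eval 0 * r) ≠ 0 := by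
    rw [map_mul]
    refine mul_ne_zero ?_ hr0
    rw [← coeff_zero_eq_eval_zero, ← coeff_map, hB0, coeff_C_zero]
    exact hb
  have hne' : j (B.eval 0 * r) ≠ 0 := by
    intro h0
    apply hne
    change PowerSeries.constantCoeff (j (B.eval 0 * r)) = 0
    rw [h0, map_zero]
  have a1 : IsAlgebraic ℂ[X] (j (B.eval 0 * r)) := (B.eval 0 * r).2
  have a2 : IsAlgebraic ℂ[X] (j (B.eval 0 * r) * CT w) := by
    rw [hfin]; exact (E.eval 0).2
  exact IsAlgebraic.of_mul (mem_nonZeroDivisors_of_ne_zero hne') a1 a2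

noncomputable def subW (d₁ d₂ : ℕ) : MvPolynomial (Fin 2) ℂ →+* PowerSeries (LaurentPolynomial ℂ) :=
  MvPolynomial.eval₂Hom (PowerSeries.C.comp LaurentPolynomial.C)
    ![PowerSeries.C (LaurentPolynomial.T d₂) * PowerSeries.X,
      PowerSeries.C (LaurentPolynomial.T (-(d₁ : ℤ))) * PowerSeries.X]

noncomputable def psiW : ℂ[X][X] →+* PowerSeries (LaurentPolynomial ℂ) :=
  (iop.comp phip).comp (mapRingHom (algebraMap ℂ[X] (PowerSeries ℂ)))

lemma psiW_CC (a : ℂ) : psiW (C (C a)) = PowerSeries.C (LaurentPolynomial.C a) := by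
  simp [psiW, phip, iop, PowerSeries.algebraMap_apply']
lemma psiW_CX : psiW (C X) = PowerSeries.X := by
  simp [psiW, phip, iop, PowerSeries.algebraMap_apply']
lemma psiW_X : psiW X = PowerSeries.C (LaurentPolynomial.T 1) := by
  simp [psiW, phip, iop, Polynomial.toLaurent_X]
lemma psiW_X_pow (n : ℕ) : psiW (X ^ n) = PowerSeries.C (LaurentPolynomial.T n) := by
  rw [map_pow, psiW_X, ← map_pow, LaurentPolynomial.T_pow, mul_one]

lemma exists_poly (d₁ d₂ : ℕ) (h₁ : 0 < d₁) (h₂ : 0 < d₂) (q : MvPolynomial (Fin 2) ℂ) :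
    ∃ M₀ : ℕ, ∀ M ≥ M₀, ∃ Q : ℂ[X][X],
      psiW Q = PowerSeries.C (LaurentPolynomial.T M) * subW d₁ d₂ q ∧
      Q.map (evalRingHom 0) = C (MvPolynomial.eval (fun _ => (0 : ℂ)) q) * X ^ M := by
  induction q using MvPolynomial.induction_on with
  | C a =>
    refine ⟨0, fun M _ => ⟨X ^ M * C (C a), ?_, ?_⟩⟩
    · rw [map_mul, psiW_X_pow, psiW_CC]
      simp [subW]
    · rw [Polynomial.map_mul, Polynomial.map_pow, map_X, map_C, coe_evalRingHom, eval_C, MvPolynomial.eval_C, mul_comm]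
  | add p q hp hq =>
    obtain ⟨M1, h1⟩ := hp
    obtain ⟨M2, h2⟩ := hq
    refine ⟨max M1 M2, fun M hM => ?_⟩
    obtain ⟨Q1, a1, b1⟩ := h1 M (le_trans (le_max_left _ _) hM)
    obtain ⟨Q2, a2, b2⟩ := h2 M (le_trans (le_max_right _ _) hM)
    refine ⟨Q1 + Q2, ?_, ?_⟩
    · rw [map_add, map_add, a1, a2, mul_add]
    · rw [Polynomial.map_add, b1, b2, map_add, map_add, add_mul]
  | mul_X p i hp =>
    obtain ⟨M1, h1⟩ := hp
    fin_cases i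
    · refine ⟨M1, fun M hM => ?_⟩
      obtain ⟨Q1, a1, b1⟩ := h1 M hM
      refine ⟨Q1 * (X ^ d₂ * C X), ?_, ?_⟩
      · rw [map_mul, map_mul, map_mul, psiW_X_pow, psiW_CX, a1]
        simp [subW, mul_assoc]
      · simp
    · refine ⟨M1 + d₁, fun M hM => ?_⟩
      obtain ⟨Q1, a1, b1⟩ := h1 (M - d₁) (by omega)
      refine ⟨Q1 * C X, ?_, ?_⟩
      · rw [map_mul, map_mul, psiW_CX, a1]
        have : (LaurentPolynomial.T ((M - d₁ : ℕ) : ℤ) : LaurentPolynomial ℂ) = LaurentPolynomial.T M * LaurentPolynomial.T (-(d₁ : ℤ)) := by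
          rw [← LaurentPolynomial.T_add]
          congr 1
          rw [Nat.cast_sub (by omega)]; ring
        rw [this, map_mul]
        simp [subW]
        ring
      · simp

def GG (t : ℂ) : Subring (PowerSeries ℂ × ℂ) where
  carrier := {x | HasSum (fun n => PowerSeries.coeff n x.1 * t ^ n) x.2}
  zero_mem' := by simpa using hasSum_zero
  one_mem' := by
    have := hasSum_ite_eq (0 : ℕ) (1 : ℂ)
    change HasSum (fun n => PowerSeries.coeff n (1 : PowerSeries ℂ) * t ^ n) 1
    convert this using 2 with n
    rw [PowerSeries.coeff_one]
    split_ifs with h <;> simp [h]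
  add_mem' := by
    intro x y hx hy
    simpa [add_mul] using HasSum.add hx hy
  neg_mem' := by
    intro x hx
    simpa using HasSum.neg hx
  mul_mem' := by
    rintro ⟨c, v⟩ ⟨d, w⟩ (hx : HasSum _ v) (hy : HasSum _ w)
    change HasSum _ (v * w)
    have h1 := summable_norm_iff.mpr hx.summable
    have h2 := summable_norm_iff.mpr hy.summable
    have h3 := tsum_mul_tsum_eq_tsum_sum_antidiagonal_of_summable_norm h1 h2
    have h4 := (summable_norm_sum_mul_antidiagonal_of_summable_norm h1 h2).of_norm.hasSum
    rw [← h3, hx.tsum_eq, hy.tsum_eq] at h4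
    have hf : (fun n => PowerSeries.coeff n (c * d) * t ^ n) = fun n => ∑ kl ∈ Finset.HasAntidiagonal.antidiagonal n,
        (PowerSeries.coeff kl.1) c * t ^ kl.1 * ((PowerSeries.coeff kl.2) d * t ^ kl.2) := by
     funext n
     change PowerSeries.coeff n (c * d) * t ^ n = _
     rw [PowerSeries.coeff_mul, Finset.sum_mul]
     refine Finset.sum_congr rfl fun kl hkl => ?_
     rw [← Finset.HasAntidiagonal.mem_antidiagonal.mp hkl, pow_add]
     ring
    change HasSum (fun n => PowerSeries.coeff n (c * d) * t ^ n) (v * w)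
    rw [hf]
    exact h4


lemma mem_GG {t : ℂ} {c : PowerSeries ℂ} {v : ℂ} :
    (c, v) ∈ GG t ↔ HasSum (fun n => PowerSeries.coeff n c * t ^ n) v := Iff.rfl

lemma GG_C (t a : ℂ) : (PowerSeries.C a, a) ∈ GG t := by
  rw [mem_GG]
  convert hasSum_ite_eq (0 : ℕ) a using 2 with n
  rw [PowerSeries.coeff_C]
  split_ifs with h <;> simp [h]

lemma GG_X (t : ℂ) : (PowerSeries.X, t) ∈ GG t := by
  rw [mem_GG]
  convert hasSum_ite_eq (1 : ℕ) t using 2 with n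
  rw [PowerSeries.coeff_X]
  split_ifs with h <;> simp [h]

lemma hasSum_antidiag {F : ℕ × ℕ → ℂ} {v : ℂ} (h : HasSum F v) :
    HasSum (fun N => ∑ kl ∈ Finset.HasAntidiagonal.antidiagonal N, F kl) v := by
  have h1 := (Finset.HasAntidiagonal.sigmaAntidiagonalEquivProd (A := ℕ)).hasSum_iff.mpr h
  refine h1.sigma fun N => ?_
  have := Finset.hasSum (Finset.HasAntidiagonal.antidiagonal N) F
  exact this

lemma coeff_zero_of_hasSum (c : PowerSeries ℂ)
    (h : ∀ᶠ t in nhds (0 : ℂ), HasSum (fun n => PowerSeries.coeff n c * t ^ n) 0) : c = 0 := by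
  have h1 : HasFPowerSeriesAt (0 : ℂ → ℂ) (FormalMultilinearSeries.ofScalars ℂ (fun n => PowerSeries.coeff n c)) 0 := by
    rw [hasFPowerSeriesAt_iff]
    filter_upwards [h] with t ht
    simpa [mul_comm] using ht
  have h2 := h1.eq_zero
  ext n
  have := congrArg (fun p => FormalMultilinearSeries.coeff p n) h2
  simp only [FormalMultilinearSeries.coeff_ofScalars] at this
  rw [this, map_zero]
  rfl

noncomputable def evs (s : ℂˣ) : LaurentPolynomial ℂ →+* ℂ := LaurentPolynomial.eval₂ (RingHom.id ℂ) s

lemma evs_inj (f : LaurentPolynomial ℂ) (h : ∀ s, evs s f = 0) : f = 0 := by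
  obtain ⟨n, g, hg⟩ := LaurentPolynomial.exists_T_pow f
  have hg0 : g = 0 := by
    refine Polynomial.eq_zero_of_infinite_isRoot g ?_
    refine Set.Infinite.mono (s := {0}ᶜ) ?_ (Set.Finite.infinite_compl (Set.finite_singleton 0))
    intro s hs
    have h1 := congrArg (evs (Units.mk0 s hs)) hg
    rw [map_mul, h, zero_mul, evs, LaurentPolynomial.eval₂_toLaurent] at h1
    rw [Polynomial.eval₂_id] at h1
    exact h1
  rw [hg0, map_zero] at hg
  have := congrArg (· * LaurentPolynomial.T (-(n : ℤ))) hg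
  simp only [zero_mul, mul_assoc, ← LaurentPolynomial.T_add] at this
  simpa using this.symm

noncomputable def wser (a : ℕ → ℕ → ℂ) (d₁ d₂ : ℕ) : PowerSeries (LaurentPolynomial ℂ) :=
  PowerSeries.mk fun N => ∑ kl ∈ Finset.HasAntidiagonal.antidiagonal N,
    LaurentPolynomial.C (a kl.1 kl.2) * LaurentPolynomial.T ((d₂ : ℤ) * kl.1 - d₁ * kl.2)

lemma subW_GG (d₁ d₂ : ℕ) (s : ℂˣ) (t : ℂ) (q : MvPolynomial (Fin 2) ℂ) :
    (PowerSeries.map (evs s) (subW d₁ d₂ q),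
      MvPolynomial.eval ![(s : ℂ) ^ d₂ * t, ((s⁻¹ : ℂˣ) : ℂ) ^ d₁ * t] q) ∈ GG t := by
  induction q using MvPolynomial.induction_on with
  | C a => 
    have := GG_C t a
    simpa [subW, evs] using this
  | add p q hp hq => 
    have := add_mem hp hq
    simpa using this
  | mul_X p i hp =>
    have h0 : ∀ i, (PowerSeries.map (evs s) (subW d₁ d₂ (MvPolynomial.X i)),
      MvPolynomial.eval ![(s : ℂ) ^ d₂ * t, ((s⁻¹ : ℂˣ) : ℂ) ^ d₁ * t] (MvPolynomial.X i)) ∈ GG t := by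
      intro i
      fin_cases i
      · have := mul_mem (GG_C t ((s : ℂ) ^ d₂)) (GG_X t)
        simpa [subW, evs] using this
      · have := mul_mem (GG_C t (((s⁻¹ : ℂˣ) : ℂ) ^ d₁)) (GG_X t)
        simpa [subW, evs] using this
    have := mul_mem hp (h0 i)
    simpa only [map_mul, Prod.mk_mul_mk] using this

lemma wser_eq (a : ℕ → ℕ → ℂ) (d₁ d₂ : ℕ) (p q : MvPolynomial (Fin 2) ℂ)
    (hq : MvPolynomial.eval (fun _ => (0 : ℂ)) q ≠ 0) (ε : ℝ) (hε : 0 < ε)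
    (h : ∀ x y : ℂ, ‖x‖ < ε → ‖y‖ < ε →
      HasSum (fun mn : ℕ × ℕ => a mn.1 mn.2 * x ^ mn.1 * y ^ mn.2)
        (MvPolynomial.eval ![x, y] p / MvPolynomial.eval ![x, y] q)) :
    subW d₁ d₂ q * wser a d₁ d₂ = subW d₁ d₂ p := by
  rw [← sub_eq_zero]
  ext1 n
  rw [map_zero]
  refine evs_inj _ fun s => ?_
  rw [← PowerSeries.coeff_map]
  suffices PowerSeries.map (evs s) (subW d₁ d₂ q * wser a d₁ d₂ - subW d₁ d₂ p) = 0 by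
    rw [this, map_zero]
  apply coeff_zero_of_hasSum
  have c1 : Continuous fun t : ℂ => (s : ℂ) ^ d₂ * t := by fun_prop
  have c2 : Continuous fun t : ℂ => ((s⁻¹ : ℂˣ) : ℂ) ^ d₁ * t := by fun_prop
  have c3 : Continuous fun t : ℂ => MvPolynomial.eval ![(s : ℂ) ^ d₂ * t, ((s⁻¹ : ℂˣ) : ℂ) ^ d₁ * t] q := by
    refine (MvPolynomial.continuous_eval q).comp ?_
    refine continuous_pi fun i => ?_
    fin_cases i
    · exact c1
    · exact c2
  have e1 : ∀ᶠ t in nhds (0 : ℂ), ‖(s : ℂ) ^ d₂ * t‖ < ε := 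
    c1.norm.continuousAt.eventually_lt_const (by simpa using hε)
  have e2 : ∀ᶠ t in nhds (0 : ℂ), ‖((s⁻¹ : ℂˣ) : ℂ) ^ d₁ * t‖ < ε := 
    c2.norm.continuousAt.eventually_lt_const (by simpa using hε)
  have e3 : ∀ᶠ t in nhds (0 : ℂ), MvPolynomial.eval ![(s : ℂ) ^ d₂ * t, ((s⁻¹ : ℂˣ) : ℂ) ^ d₁ * t] q ≠ 0 := by
    refine c3.continuousAt.eventually_ne ?_
    convert hq using 3
    ext i
    fin_cases i <;> simp
  filter_upwards [e1, e2, e3] with t h1 h2 h3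
  have hw : (PowerSeries.map (evs s) (wser a d₁ d₂), MvPolynomial.eval ![(s : ℂ) ^ d₂ * t, ((s⁻¹ : ℂˣ) : ℂ) ^ d₁ * t] p / MvPolynomial.eval ![(s : ℂ) ^ d₂ * t, ((s⁻¹ : ℂˣ) : ℂ) ^ d₁ * t] q) ∈ GG t := by
    rw [mem_GG]
    convert hasSum_antidiag (h _ _ h1 h2) using 2 with N
    rw [PowerSeries.coeff_map, wser, PowerSeries.coeff_mk, map_sum, Finset.sum_mul]
    refine Finset.sum_congr rfl fun kl hkl => ?_
    rw [evs, LaurentPolynomial.eval₂_C_mul_T, ← Finset.HasAntidiagonal.mem_antidiagonal.mp hkl, sub_eq_add_neg, zpow_add, zpow_mul, zpow_neg, zpow_mul]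
    simp only [mul_pow, RingHom.id_apply, pow_add, zpow_natCast, Units.val_mul, Units.val_pow_eq_pow_val, ← inv_pow]
    ring
  have := sub_mem (mul_mem (subW_GG d₁ d₂ s t q) hw) (subW_GG d₁ d₂ s t p)
  rw [Prod.mk_mul_mk, Prod.mk_sub_mk, mul_div_cancel₀ _ h3, sub_self, ← map_mul, ← map_sub] at this
  exact this

lemma CT_wser_GG (a : ℕ → ℕ → ℂ) (d₁ d₂ : ℕ) (h₁ : 0 < d₁) (hc : Nat.Coprime d₁ d₂) (u : ℂ)
    (hs : Summable (fun mn : ℕ × ℕ => a mn.1 mn.2 * u ^ mn.1 * u ^ mn.2)) :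
    (CT (wser a d₁ d₂), ∑' r : ℕ, a (d₁ * r) (d₂ * r) * (u ^ (d₁ + d₂)) ^ r) ∈ GG u := by
  rw [mem_GG]
  let F : ℕ × ℕ → ℂ := Set.indicator {mn | d₂ * mn.1 = d₁ * mn.2} (fun mn => a mn.1 mn.2 * u ^ mn.1 * u ^ mn.2)
  have hF : Summable F := hs.indicator _
  let i : ℕ → ℕ × ℕ := fun r => (d₁ * r, d₂ * r)
  have hi : Function.Injective i := by
    intro x y hxy
    exact Nat.eq_of_mul_eq_mul_left h₁ (congrArg Prod.fst hxy)
  have hsupp : ∀ x ∉ Set.range i, F x = 0 := by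
    intro x hx
    refine Set.indicator_of_notMem (fun hm => hx ?_) _
    simp only [Set.mem_ofPred_eq] at hm
    obtain ⟨r, hr⟩ : d₁ ∣ x.1 := hc.dvd_of_dvd_mul_left (Dvd.intro _ hm.symm)
    refine ⟨r, Prod.ext hr.symm ?_⟩
    refine Nat.eq_of_mul_eq_mul_left h₁ ?_
    rw [← hm, hr]
    simp only [i]; ring
  have hFi : F ∘ i = fun r => a (d₁ * r) (d₂ * r) * (u ^ (d₁ + d₂)) ^ r := by
    ext r
    simp only [F, i, Function.comp]
    rw [Set.indicator_of_mem (by simp only [Set.mem_ofPred_eq]; ring)]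
    ring
  have hsum : HasSum F (∑' r : ℕ, a (d₁ * r) (d₂ * r) * (u ^ (d₁ + d₂)) ^ r) := by
    rw [← hi.hasSum_iff hsupp, ← hFi]
    exact (hF.comp_injective hi).hasSum
  convert hasSum_antidiag hsum using 2 with N
  rw [CT, PowerSeries.coeff_mk, wser, PowerSeries.coeff_mk, AddMonoidAlgebra.coeff_sum, Finsupp.finsetSum_apply, Finset.sum_mul]
  refine Finset.sum_congr rfl fun kl hkl => ?_
  rw [← LaurentPolynomial.single_eq_C_mul_T, AddMonoidAlgebra.coeff_single, Finsupp.single_apply, ← Finset.HasAntidiagonal.mem_antidiagonal.mp hkl]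
  simp only [F, Set.indicator_apply, Set.mem_ofPred_eq, sub_eq_zero]
  have : ((d₂ : ℤ) * kl.1 = d₁ * kl.2) ↔ (d₂ * kl.1 = d₁ * kl.2) := by norm_cast
  simp only [this]
  split_ifs <;> ring

lemma restrict_alg {T U R : Type*} [CommRing T] [IsDomain T] [CommRing U] [IsDomain U] [CommRing R] [IsDomain R]
    (i : T →+* U) (j : U →+* R) (hj : Function.Injective j) (hi : i.IsIntegral) (g : R)
    (h : ∃ P : U[X], P ≠ 0 ∧ eval₂ j g P = 0) :
    ∃ P : T[X], P ≠ 0 ∧ eval₂ (j.comp i) g P = 0 := by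
  let _ : Algebra T U := i.toAlgebra
  let _ : Algebra U R := j.toAlgebra
  let _ : Algebra T R := (j.comp i).toAlgebra
  have : IsScalarTower T U R := IsScalarTower.of_algebraMap_eq' rfl
  have : Algebra.IsIntegral T U := ⟨hi⟩
  have h1 : IsAlgebraic U g := h
  have h2 : IsAlgebraic T g := h1.restrictScalars T
  exact h2

lemma expand_integral (N : ℕ) (hN : 0 < N) : (expand ℂ N : ℂ[X] →+* ℂ[X]).IsIntegral := by
  intro p
  induction p using Polynomial.induction_on with
  | C a =>
    have := RingHom.isIntegralElem_map (f := (expand ℂ N : ℂ[X] →+* ℂ[X])) (x := C a)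
    simpa using this
  | add p q hp hq => exact RingHom.IsIntegralElem.add _ hp hq
  | monomial n a h => 
    rw [pow_succ, ← mul_assoc]
    refine RingHom.IsIntegralElem.mul _ h ?_
    refine ⟨X ^ N - C X, monic_X_pow_sub_C _ hN.ne', ?_⟩
    simp

theorem diagonal_of_rational_is_algebraic (a : ℕ → ℕ → ℂ)
    (ha : IsRationalBivariateSeries a) (δ₁ δ₂ : ℕ) (hδ₁ : 0 < δ₁) (hδ₂ : 0 < δ₂)
    (hcop : Nat.Coprime δ₁ δ₂) :
    IsAlgebraicFn (fun t => ∑' r : ℕ, a (δ₁ * r) (δ₂ * r) * t ^ r) := by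
  obtain ⟨p, q, hq, ε, hε, hsum⟩ := ha
  have hw := wser_eq a δ₁ δ₂ p q hq ε hε hsum
  obtain ⟨M1, h1⟩ := exists_poly δ₁ δ₂ hδ₁ hδ₂ q
  obtain ⟨M2, h2⟩ := exists_poly δ₁ δ₂ hδ₁ hδ₂ p
  obtain ⟨Q, hQ, hQ0⟩ := h1 (max M1 M2) (le_max_left _ _)
  obtain ⟨P, hP, -⟩ := h2 (max M1 M2) (le_max_right _ _)
  have halg : IsAlgebraic ℂ[X] (CT (wser a δ₁ δ₂)) := by
    refine CT_algebraic Q P _ _ hq hQ0 _ ?_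
    change psiW Q * _ = psiW P
    rw [hQ, hP, mul_assoc, hw]
  have hN : 0 < δ₁ + δ₂ := by omega
  obtain ⟨Z, hZ0, hZ⟩ := restrict_alg (expand ℂ (δ₁ + δ₂) : ℂ[X] →+* ℂ[X])
    (algebraMap ℂ[X] (PowerSeries ℂ)) alg_inj (expand_integral _ hN) _ halg
  refine ⟨Z, hZ0, ε ^ (δ₁ + δ₂), pow_pos hε _, fun t ht => ?_⟩
  obtain ⟨u, hu⟩ := IsAlgClosed.exists_pow_nat_eq t hN
  have hun : ‖u‖ < ε := by
    rw [← hu, norm_pow] at ht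
    exact lt_of_pow_lt_pow_left₀ _ hε.le ht
  have hG := CT_wser_GG a δ₁ δ₂ hδ₁ hcop u (hsum u u hun hun).summable
  rw [hu] at hG
  set v := ∑' r : ℕ, a (δ₁ * r) (δ₂ * r) * t ^ r with hv
  set j := (algebraMap ℂ[X] (PowerSeries ℂ)).comp (expand ℂ (δ₁ + δ₂) : ℂ[X] →+* ℂ[X]) with hj
  have hJ : ∀ c : ℂ[X], (j c, c.eval t) ∈ GG u := by
    intro c
    induction c using Polynomial.induction_on with
    | C b => simpa [hj, PowerSeries.algebraMap_apply'] using GG_C u b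
    | add p q hp hq => simpa using add_mem hp hq
    | monomial n b h =>
      have := mul_mem h (pow_mem (GG_X u) (δ₁ + δ₂))
      rw [Prod.pow_mk, Prod.mk_mul_mk] at this
      convert this using 2
      · rw [pow_succ, ← mul_assoc, map_mul]
        simp [hj, PowerSeries.algebraMap_apply']
      · rw [hu]; simp [pow_succ, mul_assoc]
  have hfin : ∀ Y : ℂ[X][X], (eval₂ j (CT (wser a δ₁ δ₂)) Y, (Y.map (evalRingHom t)).eval v) ∈ GG u := by
    intro Y
    induction Y using Polynomial.induction_on' with
    | add p q hp hq => simpa [eval₂_add] using add_mem hp hq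
    | monomial n c =>
      have := mul_mem (hJ c) (pow_mem hG n)
      simpa [eval₂_monomial] using this
  have := hfin Z
  rw [hZ, mem_GG] at this
  simp only [map_zero, zero_mul] at this
  exact (this.unique hasSum_zero)
end

section
/- The (1,1)-diagonal of the Taylor series of a bivariate rational function p(x,y)/q(x,y) with q(0,0)≠0, namely g(t) = ∑_{r≥0} a_{r,r} t^r where p/q = ∑ a_{m,n}x^m y^n, is an algebraic function. -/
open PowerSeries in
theorem maxIdeal_eq : IsLocalRing.maximalIdeal ℂ⟦X⟧ = Ideal.span {PowerSeries.X} := by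
  exact PowerSeries.maximalIdeal_eq_span_X
open Polynomial in
theorem weier_factor (D : (PowerSeries ℂ)[X]) (hD : D.map (PowerSeries.constantCoeff (R := ℂ)) ≠ 0) :
    ∃ D1 U a b : (PowerSeries ℂ)[X], D = D1 * U ∧ D1.Monic ∧
      D1.map (PowerSeries.constantCoeff (R := ℂ)) = X ^ D1.natDegree ∧
      PowerSeries.constantCoeff (U.coeff 0) ≠ 0 ∧ a * U + b * D1 = 1 := by
  have : IsAdicComplete (IsLocalRing.maximalIdeal (PowerSeries ℂ)) (PowerSeries ℂ) := by
    rw [maxIdeal_eq]; infer_instance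
  have hmem : ∀ x : PowerSeries ℂ, x ∈ IsLocalRing.maximalIdeal (PowerSeries ℂ) ↔ PowerSeries.constantCoeff x = 0 := by
    intro x
    rw [maxIdeal_eq, Ideal.mem_span_singleton, PowerSeries.X_dvd_iff]
  have hg : (D : PowerSeries (PowerSeries ℂ)).map (IsLocalRing.residue (PowerSeries ℂ)) ≠ 0 := by
    intro h
    apply hD
    ext i
    have := congrArg (PowerSeries.coeff i) h
    simp [IsLocalRing.residue_eq_zero_iff, hmem] at this
    simpa using this
  obtain ⟨D1, H, hH⟩ := PowerSeries.exists_isWeierstrassFactorization hg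
  have hdist := hH.isDistinguishedAt
  have hne : IsLocalRing.maximalIdeal (PowerSeries ℂ) ≠ ⊤ := Ideal.IsMaximal.ne_top inferInstance
  have hdvd : ∀ (p : (PowerSeries ℂ)[X]) (w : PowerSeries (PowerSeries ℂ)), (p : PowerSeries (PowerSeries ℂ)) = D1 * w → ∃ v : (PowerSeries ℂ)[X], p = D1 * v ∧ w = v := by
    intro p w h
    have hdiv := hdist.isWeierstrassDivisorAt' 
    have hord := hdist.coe_natDegree_eq_order_map (D1 : PowerSeries (PowerSeries ℂ)) 1 (by simp [hmem]) (by simp)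
    have := hdiv.eq_of_mul_add_eq_mul_add (q := w) (q' := (p /ₘ D1 : (PowerSeries ℂ)[X])) (r := 0) (r' := p %ₘ D1) (by simp) (by
      rw [← hord]
      have := degree_modByMonic_lt p hdist.monic
      rwa [degree_eq_natDegree hdist.monic.ne_zero] at this) (by
        rw [← Polynomial.coe_mul, ← Polynomial.coe_add, add_comm (D1 * _), modByMonic_add_div]
        simp [h])
    refine ⟨p /ₘ D1, ?_, this.1⟩
    conv_lhs => rw [← modByMonic_add_div p D1, ← this.2]
    simp
  obtain ⟨U, hU, hUH⟩ := hdvd D H hH.eq_mul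
  have hunit := hH.isUnit
  obtain ⟨b', a, hab⟩ : ∃ (b' : PowerSeries (PowerSeries ℂ)) (a : (PowerSeries ℂ)[X]), ((hunit.unit⁻¹ : (PowerSeries (PowerSeries ℂ))ˣ) : PowerSeries (PowerSeries ℂ)) = D1 * b' + a := by
    have hdiv := hdist.isWeierstrassDivisorAt' 
    exact ⟨_, _, (hdiv.isWeierstrassDivisionAt_div_mod _).2⟩
  have h1 : ((1 - a * U : (PowerSeries ℂ)[X]) : PowerSeries (PowerSeries ℂ)) = D1 * (b' * H) := by
    have : ((hunit.unit⁻¹ : (PowerSeries (PowerSeries ℂ))ˣ) : PowerSeries (PowerSeries ℂ)) * H = 1 := hunit.val_inv_mul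
    rw [Polynomial.coe_sub, Polynomial.coe_mul, ← hUH, Polynomial.coe_one, ← this, hab]
    ring
  obtain ⟨b, hb, -⟩ := hdvd _ _ h1
  refine ⟨D1, U, a, b, hU, hdist.monic, ?_, ?_, ?_⟩
  · ext i
    rw [coeff_map, coeff_X_pow]
    split_ifs with h
    · subst h; simp [hdist.monic]
    · rcases lt_or_gt_of_ne h with h | h
      · exact (hmem _).1 (hdist.mem h)
      · simp [coeff_eq_zero_of_natDegree_lt h]
  · have := hunit.map (PowerSeries.constantCoeff (R := PowerSeries ℂ))
    rw [hUH] at this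
    have := this.map (PowerSeries.constantCoeff (R := ℂ))
    simpa using this.ne_zero
  · rw [mul_comm b, ← hb]; ring

open Polynomial in
theorem alg_coeff_core {R E A L : Type*} [CommRing R] [Field E] [CommRing A] [Field L]
    (ρ : R →+* A) (φ : A →+* L) (γ : R →+* E) (ψ : E →+* L)
    (hcomp : φ.comp ρ = ψ.comp γ) (hφ : Function.Injective φ)
    (D0 N0 : R[X]) (D1 U a b α β : A[X])
    (hD : D0.map ρ = D1 * U) (hm : D1.Monic)
    (hab : a * U + b * D1 = 1) (hα : α.degree < D1.degree)
    (hN : N0.map ρ = α * U + β * D1) (d1 : E[X]) (hd1 : d1.map ψ = D1.map φ) (i : ℕ) :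
    ∃ e : E, φ (α.coeff i) = ψ e := by
  have hd1m : d1.Monic := by
    have := hm.map φ
    rw [← hd1] at this
    exact Polynomial.monic_of_injective ψ.injective this
  have hdeg : d1.degree = D1.degree := by
    rw [← degree_map d1 ψ, hd1, degree_map_eq_of_injective hφ]
  obtain ⟨u, hu⟩ : ∃ u : E[X], u.map ψ = U.map φ := by
    refine ⟨D0.map γ /ₘ d1, ?_⟩
    rw [map_divByMonic _ hd1m, hd1, map_map, ← hcomp, ← map_map, hD, Polynomial.map_mul, mul_divByMonic_cancel_left _ (hm.map φ)]
  have hcop : IsCoprime u d1 := by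
    rw [← isCoprime_map ψ, hd1, hu]
    refine ⟨a.map φ, b.map φ, ?_⟩
    rw [← Polynomial.map_mul, ← Polynomial.map_mul, ← Polynomial.map_add, hab, Polynomial.map_one]
  obtain ⟨a', b', hab'⟩ := hcop
  obtain ⟨α', hα', c, hc⟩ : ∃ α' : E[X], α'.degree < d1.degree ∧ ∃ c, N0.map γ = α' * u + c * d1 := by
    refine ⟨(N0.map γ * a') %ₘ d1, degree_modByMonic_lt _ hd1m, ?_⟩
    have := modByMonic_add_div (N0.map γ * a') d1
    refine ⟨(N0.map γ * a') /ₘ d1 * u + N0.map γ * b', ?_⟩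
    linear_combination (-N0.map γ) * hab' - u * this
  have hc' := congrArg (Polynomial.map ψ) hc
  have hN' := congrArg (Polynomial.map φ) hN
  rw [map_map, ← hcomp] at hc'
  rw [map_map, hc'] at hN'
  simp only [Polynomial.map_add, Polynomial.map_mul, hd1, hu] at hN'
  have hz : α.map φ = α'.map ψ := by
    have hdvd : D1.map φ ∣ α.map φ - α'.map ψ := by
      have hab2 := congrArg (Polynomial.map φ) hab
      simp only [Polynomial.map_add, Polynomial.map_mul, Polynomial.map_one] at hab2
      refine ⟨a.map φ * (c.map ψ - β.map φ) + b.map φ * (α.map φ - α'.map ψ), ?_⟩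
      linear_combination -(α.map φ - α'.map ψ) * hab2 + (-a.map φ) * hN'
    have := eq_zero_of_dvd_of_degree_lt hdvd (by
      refine (degree_sub_le _ _).trans_lt (max_lt ?_ ?_)
      · rwa [degree_map_eq_of_injective hφ, degree_map_eq_of_injective hφ]
      · rwa [degree_map, degree_map_eq_of_injective hφ, ← hdeg])
    exact sub_eq_zero.1 this
  exact ⟨α'.coeff i, by rw [← coeff_map, ← coeff_map, hz]⟩

open Polynomial in
theorem alg_coeff_gen {R K A L : Type*} [CommRing R] [IsDomain R] [Field K] [Algebra R K] [IsFractionRing R K]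
    [CommRing A] [Field L] [Algebra R A] [Algebra A L] [Algebra R L] [Algebra K L]
    [IsScalarTower R A L] [IsScalarTower R K L] (hφ : Function.Injective (algebraMap A L))
    (D0 N0 : R[X]) (hD0 : D0 ≠ 0) (D1 U a b α β : A[X])
    (hD : D0.map (algebraMap R A) = D1 * U) (hm : D1.Monic)
    (hab : a * U + b * D1 = 1) (hα : α.degree < D1.degree)
    (hN : N0.map (algebraMap R A) = α * U + β * D1) (i : ℕ) :
    IsAlgebraic R (α.coeff i) := by
  have hRK : Function.Injective (algebraMap R K) := IsFractionRing.injective R K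
  have hne : D0.map (algebraMap R K) ≠ 0 := (Polynomial.map_ne_zero_iff hRK).2 hD0
  have hlift : D1.map (algebraMap A L) ∈ lifts (algebraMap (integralClosure K L) L) := by
    refine integralClosure.mem_lifts_of_monic_of_dvd_map L (monic_mul_leadingCoeff_inv hne) (hm.map _) ?_
    rw [Polynomial.map_mul, map_map, ← IsScalarTower.algebraMap_eq, IsScalarTower.algebraMap_eq R A L, ← map_map, hD, Polynomial.map_mul, mul_assoc]
    exact dvd_mul_right _ _
  rw [lifts_iff_coeff_lifts] at hlift
  have hlift2 : D1.map (algebraMap A L) ∈ lifts (algebraMap (algebraicClosure K L) L) := by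
    rw [lifts_iff_coeff_lifts]
    intro n
    obtain ⟨x, hx⟩ := hlift n
    exact ⟨⟨x.1, x.2⟩, hx⟩
  obtain ⟨d1, hd1⟩ := (mem_lifts _).1 hlift2
  obtain ⟨e, he⟩ := alg_coeff_core (algebraMap R A) (algebraMap A L) ((algebraMap K (algebraicClosure K L)).comp (algebraMap R K)) (algebraMap (algebraicClosure K L) L) (by
    rw [← RingHom.comp_assoc, ← IsScalarTower.algebraMap_eq, ← IsScalarTower.algebraMap_eq, ← IsScalarTower.algebraMap_eq]) hφ D0 N0 D1 U a b α β hD hm hab hα hN d1 hd1 i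
  have h2 : IsAlgebraic K (algebraMap A L (α.coeff i)) := by
    rw [he]
    exact mem_algebraicClosure_iff.1 e.2
  have h3 : IsAlgebraic R (algebraMap A L (α.coeff i)) := (IsFractionRing.isAlgebraic_iff R K L).2 h2
  exact (isAlgebraic_algebraMap_iff hφ).1 h3

open scoped RatFunc in
open Polynomial in
theorem alg_coeff
    (D0 N0 : ℂ[X][X]) (hD0 : D0 ≠ 0) (D1 U a b α β : (PowerSeries ℂ)[X])
    (hD : D0.map (algebraMap ℂ[X] (PowerSeries ℂ)) = D1 * U) (hm : D1.Monic)
    (hab : a * U + b * D1 = 1) (hα : α.degree < D1.degree)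
    (hN : N0.map (algebraMap ℂ[X] (PowerSeries ℂ)) = α * U + β * D1) (i : ℕ) :
    IsAlgebraic ℂ[X] (α.coeff i) :=
  have : IsScalarTower ℂ[X] (PowerSeries ℂ) (LaurentSeries ℂ) := IsScalarTower.of_algebraMap_eq fun _ => rfl
  alg_coeff_gen (K := RatFunc ℂ) (L := LaurentSeries ℂ) (IsFractionRing.injective (PowerSeries ℂ) _) D0 N0 hD0 D1 U a b α β hD hm hab hα hN i


noncomputable def psi0 : Polynomial (PowerSeries ℂ) →+* PowerSeries (PowerSeries ℂ) :=
  Polynomial.eval₂RingHom (PowerSeries.map (PowerSeries.C (R := ℂ))) (PowerSeries.C PowerSeries.X)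

noncomputable def iota0 : PowerSeries (PowerSeries ℂ) →+* PowerSeries (LaurentSeries ℂ) :=
  PowerSeries.map (HahnSeries.ofPowerSeries ℤ ℂ)

noncomputable def sv : PowerSeries (LaurentSeries ℂ) := PowerSeries.C (HahnSeries.single 1 1)

noncomputable def si : PowerSeries (LaurentSeries ℂ) := PowerSeries.C (HahnSeries.single (-1) 1)

theorem sv_si : sv * si = 1 := by
  simp [sv, si, ← map_mul]

noncomputable def twist : PowerSeries (PowerSeries ℂ) →+* PowerSeries (LaurentSeries ℂ) :=
  (PowerSeries.rescale (HahnSeries.single (-1) 1)).comp iota0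

noncomputable def qmap : MvPolynomial (Fin 2) ℂ →+* PowerSeries (PowerSeries ℂ) :=
  MvPolynomial.eval₂Hom (PowerSeries.C.comp PowerSeries.C) ![PowerSeries.C PowerSeries.X, PowerSeries.X]

noncomputable def iotaI : PowerSeries (Polynomial ℂ) →+* PowerSeries (LaurentSeries ℂ) :=
  PowerSeries.map (Polynomial.eval₂RingHom (HahnSeries.C) (HahnSeries.single (-1) 1))

theorem iota0_psi0_C (a : PowerSeries ℂ) : iota0 (psi0 (Polynomial.C a)) = PowerSeries.map HahnSeries.C a := by
  ext n : 1
  simp [iota0, psi0]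

theorem iota0_psi0_X : iota0 (psi0 Polynomial.X) = sv := by
  simp [iota0, psi0, sv]

theorem twist_C (a : PowerSeries ℂ) : twist (PowerSeries.C a) = PowerSeries.C (HahnSeries.ofPowerSeries ℤ ℂ a) := by
  ext n : 1
  simp [iota0, twist, PowerSeries.coeff_C]
  split_ifs with h
  · subst h; simp
  · rfl

theorem twist_X : sv * twist PowerSeries.X = PowerSeries.X := by
  ext n : 1
  simp only [iota0, twist, RingHom.comp_apply, PowerSeries.map_X, sv, PowerSeries.coeff_C_mul, PowerSeries.coeff_rescale, PowerSeries.coeff_X]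
  split_ifs with h
  · subst h; simp
  · simp

theorem exists_clear (q : MvPolynomial (Fin 2) ℂ) : ∃ (D : Polynomial (Polynomial ℂ)) (d : ℕ),
    iota0 (psi0 (D.map (algebraMap (Polynomial ℂ) (PowerSeries ℂ)))) = sv ^ d * twist (qmap q) := by
  induction q using MvPolynomial.induction_on with
  | C a =>
    refine ⟨Polynomial.C (Polynomial.C a), 0, ?_⟩
    rw [Polynomial.map_C, iota0_psi0_C]
    simp only [qmap, MvPolynomial.coe_eval₂Hom, MvPolynomial.eval₂_C, RingHom.comp_apply, twist_C]
    ext n : 1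
    simp [PowerSeries.algebraMap_apply', PowerSeries.coeff_C]
  | add p q hp hq =>
    obtain ⟨D, d, h⟩ := hp
    obtain ⟨D', d', h'⟩ := hq
    refine ⟨Polynomial.X ^ d' * D + Polynomial.X ^ d * D', d + d', ?_⟩
    simp only [Polynomial.map_add, Polynomial.map_mul, Polynomial.map_pow, Polynomial.map_X, map_add, map_mul, map_pow, h, h', iota0_psi0_X]
    ring
  | mul_X p i hp =>
    obtain ⟨D, d, h⟩ := hp
    fin_cases i
    · refine ⟨D * Polynomial.X, d, ?_⟩
      have : twist (qmap (MvPolynomial.X 0)) = sv := by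
        simp [qmap, twist_C, sv]
      simp only [Polynomial.map_mul, Polynomial.map_X, map_mul, h, iota0_psi0_X, Fin.zero_eta, this]
      ring
    · refine ⟨D * Polynomial.C Polynomial.X, d + 1, ?_⟩
      have h1 : twist (qmap (MvPolynomial.X 1)) = twist PowerSeries.X := by
        simp [qmap]
      have h2 : PowerSeries.map HahnSeries.C (algebraMap (Polynomial ℂ) (PowerSeries ℂ) Polynomial.X) = (PowerSeries.X : PowerSeries (LaurentSeries ℂ)) := by
        simp [PowerSeries.algebraMap_apply']
      simp only [Polynomial.map_mul, Polynomial.map_C, map_mul, h, iota0_psi0_C, Fin.mk_one, h1, h2, ← twist_X]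
      ring

theorem exists_inf (α : Polynomial (PowerSeries ℂ)) (n : ℕ) (hn : α.natDegree ≤ n) :
    ∃ w : PowerSeries (Polynomial ℂ), iota0 (psi0 α) = sv ^ n * iotaI w ∧
      PowerSeries.map (Polynomial.constantCoeff) w = α.coeff n ∧
      PowerSeries.constantCoeff w = ∑ i ∈ Finset.range (n + 1),
        Polynomial.C (PowerSeries.constantCoeff (α.coeff i)) * Polynomial.X ^ (n - i) := by
  refine ⟨∑ i ∈ Finset.range (n + 1),
        PowerSeries.map Polynomial.C (α.coeff i) * PowerSeries.C Polynomial.X ^ (n - i), ?_, ?_, ?_⟩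
  · conv_lhs => rw [α.as_sum_range_C_mul_X_pow' (Nat.lt_succ_of_le hn)]
    have hX : iotaI (PowerSeries.C Polynomial.X) = si := by
      simp [iotaI, si]
    have hC : ∀ a, iotaI (PowerSeries.map Polynomial.C a) = PowerSeries.map HahnSeries.C a := by
      intro a
      ext n : 1
      simp [iotaI]
    simp only [map_sum, map_mul, map_pow, iota0_psi0_C, iota0_psi0_X, Finset.mul_sum, hX, hC]
    refine Finset.sum_congr rfl fun i hi => ?_
    have hi : i ≤ n := Nat.lt_succ_iff.1 (Finset.mem_range.1 hi)
    obtain ⟨k, rfl⟩ := Nat.exists_eq_add_of_le hi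
    have : sv ^ k * si ^ k = 1 := by rw [← mul_pow, sv_si, one_pow]
    rw [Nat.add_sub_cancel_left, pow_add]
    linear_combination (-PowerSeries.map HahnSeries.C (α.coeff i) * sv ^ i) * this
  · rw [map_sum, Finset.sum_range_succ, Finset.sum_eq_zero]
    · ext m
      simp
    · intro i hi
      have hi : i < n := (Finset.mem_range.1 hi)
      simp [zero_pow (Nat.sub_ne_zero_of_lt hi)]
  · simp
    rfl

/-- coefficient of `s^0` -/
noncomputable def cz : PowerSeries (LaurentSeries ℂ) →+ PowerSeries ℂ where
  toFun r := PowerSeries.mk fun n => (PowerSeries.coeff n r).coeff 0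
  map_zero' := by ext; simp
  map_add' := by intros; ext; simp

theorem cz_pos (w : PowerSeries (PowerSeries ℂ)) : cz (sv * iota0 w) = 0 := by
  ext n
  simp only [cz, sv, iota0, AddMonoidHom.coe_mk, ZeroHom.coe_mk, PowerSeries.coeff_mk, PowerSeries.coeff_C_mul, PowerSeries.coeff_map]
  rw [show (0 : ℤ) = (-1) + 1 by norm_num, HahnSeries.coeff_single_mul_add, one_mul, PowerSeries.coeff_coe]
  simp

theorem cz_twist (w : PowerSeries (PowerSeries ℂ)) : cz (twist w) = PowerSeries.mk fun n => PowerSeries.coeff n (PowerSeries.coeff n w) := by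
  ext n
  simp only [cz, twist, iota0, RingHom.comp_apply, AddMonoidHom.coe_mk, ZeroHom.coe_mk, PowerSeries.coeff_mk, PowerSeries.coeff_rescale, PowerSeries.coeff_map]
  rw [HahnSeries.single_pow, show (0 : ℤ) = (n : ℤ) + n • (-1) by simp, HahnSeries.coeff_single_mul_add, one_pow, one_mul, HahnSeries.ofPowerSeries_apply_coeff]

theorem cz_inf (w : PowerSeries (Polynomial ℂ)) : cz (iotaI w) = PowerSeries.map Polynomial.constantCoeff w := by
  ext n
  simp only [cz, iotaI, AddMonoidHom.coe_mk, ZeroHom.coe_mk, PowerSeries.coeff_mk, PowerSeries.coeff_map]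
  generalize PowerSeries.coeff n w = p
  induction p using Polynomial.induction_on' with
  | add p q hp hq => simp only [map_add, HahnSeries.coeff_add, hp, hq]
  | monomial n a =>
    simp only [Polynomial.coe_eval₂RingHom, Polynomial.eval₂_monomial, HahnSeries.single_pow, HahnSeries.C_apply, HahnSeries.single_mul_single, HahnSeries.coeff_single, Polynomial.constantCoeff_apply, Polynomial.coeff_monomial]
    by_cases h : n = 0
    · subst h; simp
    · simp [h]

theorem formal_alg (p q : MvPolynomial (Fin 2) ℂ) (f : PowerSeries (PowerSeries ℂ))
    (hf : qmap q * f = qmap p)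
    (hq : PowerSeries.constantCoeff (PowerSeries.constantCoeff (qmap q)) ≠ 0) :
    IsAlgebraic (Polynomial ℂ) (PowerSeries.mk fun n => PowerSeries.coeff n (PowerSeries.coeff n f)) := by
  obtain ⟨D0', d', hD0'⟩ := exists_clear q
  obtain ⟨N0', e', hN0'⟩ := exists_clear p
  -- D = s^(d'+e'+1) q, N = s^(d'+e') p
  obtain ⟨D0, hD0⟩ : ∃ D0 : Polynomial (Polynomial ℂ), iota0 (psi0 (D0.map (algebraMap (Polynomial ℂ) (PowerSeries ℂ)))) = sv ^ (d' + e' + 1) * twist (qmap q) :=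
    ⟨Polynomial.X ^ (e' + 1) * D0', by
      simp only [Polynomial.map_mul, Polynomial.map_pow, Polynomial.map_X, map_mul, map_pow, hD0', iota0_psi0_X]
      ring⟩
  obtain ⟨N0, hN0⟩ : ∃ N0 : Polynomial (Polynomial ℂ), iota0 (psi0 (N0.map (algebraMap (Polynomial ℂ) (PowerSeries ℂ)))) = sv ^ (d' + e') * twist (qmap p) :=
    ⟨Polynomial.X ^ d' * N0', by
      simp only [Polynomial.map_mul, Polynomial.map_pow, Polynomial.map_X, map_mul, map_pow, hN0', iota0_psi0_X]
      ring⟩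
  have hsv0 : sv ≠ 0 := left_ne_zero_of_mul_eq_one sv_si
  have hne : (D0.map (algebraMap (Polynomial ℂ) (PowerSeries ℂ))).map (PowerSeries.constantCoeff (R := ℂ)) ≠ 0 := by
    intro h
    have key : ∀ D : Polynomial (PowerSeries ℂ), PowerSeries.constantCoeff (iota0 (psi0 D)) = (D.map (PowerSeries.constantCoeff (R := ℂ))).eval₂ HahnSeries.C (HahnSeries.single (1 : ℤ) 1) := by
      intro D
      induction D using Polynomial.induction_on' with
      | add p q hp hq => simp only [map_add, Polynomial.map_add, Polynomial.eval₂_add, hp, hq]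
      | monomial n a =>
        rw [← Polynomial.C_mul_X_pow_eq_monomial]
        simp only [map_mul, map_pow, iota0_psi0_C, iota0_psi0_X, Polynomial.map_mul, Polynomial.map_pow, Polynomial.map_X, Polynomial.map_C, Polynomial.eval₂_mul, Polynomial.eval₂_pow, Polynomial.eval₂_X, Polynomial.eval₂_C]
        have hc : PowerSeries.constantCoeff ((PowerSeries.map HahnSeries.C) a) = (HahnSeries.C (PowerSeries.constantCoeff a) : LaurentSeries ℂ) := by
          rw [← PowerSeries.coeff_zero_eq_constantCoeff_apply, PowerSeries.coeff_map, PowerSeries.coeff_zero_eq_constantCoeff_apply]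
        rw [hc]
        simp [sv]
    have h2 := key (D0.map (algebraMap (Polynomial ℂ) (PowerSeries ℂ)))
    rw [h, hD0, Polynomial.eval₂_zero, map_mul, map_pow, mul_eq_zero] at h2
    rcases h2 with h2 | h2
    · have := eq_zero_of_pow_eq_zero h2
      simp [sv] at this
    · apply hq
      have h3 : PowerSeries.constantCoeff (twist (qmap q)) = HahnSeries.ofPowerSeries ℤ ℂ (PowerSeries.constantCoeff (qmap q)) := by
        rw [← PowerSeries.coeff_zero_eq_constantCoeff_apply]
        simp [twist, iota0]
      rw [h3, map_eq_zero_iff _ HahnSeries.ofPowerSeries_injective] at h2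
      rw [h2, map_zero]
  have hD0ne : D0 ≠ 0 := by rintro rfl; simp at hne
  obtain ⟨D1, U, a, b, hDU, hm, hD1, hU, hab⟩ := weier_factor _ hne
  set N := N0.map (algebraMap (Polynomial ℂ) (PowerSeries ℂ)) with hNdef
  obtain ⟨α, hα, β, hαβ⟩ : ∃ α : Polynomial (PowerSeries ℂ), α.degree < D1.degree ∧ ∃ β, N = α * U + β * D1 := by
    refine ⟨(N * a) %ₘ D1, Polynomial.degree_modByMonic_lt _ hm, ?_⟩
    have := Polynomial.modByMonic_add_div (N * a) D1
    refine ⟨(N * a) /ₘ D1 * U + N * b, ?_⟩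
    linear_combination (-N) * hab - U * this
  have halg := alg_coeff D0 N0 hD0ne D1 U a b α β hDU hm hab hα hαβ
  -- U unit
  have hUu : IsUnit (psi0 U) := by
    rw [PowerSeries.isUnit_iff_constantCoeff, PowerSeries.isUnit_iff_constantCoeff, isUnit_iff_ne_zero]
    have : PowerSeries.constantCoeff (PowerSeries.constantCoeff (psi0 U)) = PowerSeries.constantCoeff (U.coeff 0) := by
      have key : ∀ D : Polynomial (PowerSeries ℂ), PowerSeries.constantCoeff (PowerSeries.constantCoeff (psi0 D)) = PowerSeries.constantCoeff (D.coeff 0) := by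
        intro D
        induction D using Polynomial.induction_on' with
        | add p q hp hq => simp only [map_add, Polynomial.coeff_add, hp, hq]
        | monomial n a =>
          have hc : PowerSeries.constantCoeff ((PowerSeries.map (PowerSeries.C (R := ℂ))) a) = PowerSeries.C (PowerSeries.constantCoeff a) := by
            rw [← PowerSeries.coeff_zero_eq_constantCoeff_apply, PowerSeries.coeff_map, PowerSeries.coeff_zero_eq_constantCoeff_apply]
          simp only [psi0, Polynomial.coe_eval₂RingHom, Polynomial.eval₂_monomial, map_mul, map_pow, hc, Polynomial.coeff_monomial]
          by_cases h : n = 0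
          · subst h; simp
          · simp [h]
      exact key U
    rwa [this]
  obtain ⟨v, hv⟩ := hUu.exists_right_inv
  obtain ⟨w1, hw1, hw1b, hw1c⟩ := exists_inf D1 D1.natDegree le_rfl
  have hw1u : IsUnit w1 := by
    rw [PowerSeries.isUnit_iff_constantCoeff, hw1c, Finset.sum_range_succ, Finset.sum_eq_zero]
    · simp [hm]
    · intro i hi
      have hi := Finset.mem_range.1 hi
      rw [← Polynomial.coeff_map, hD1, Polynomial.coeff_X_pow, if_neg hi.ne]
      simp
  obtain ⟨y1, hy1⟩ := hw1u.exists_right_inv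
  obtain ⟨w2, hw2, hw2a⟩ : ∃ w2 : PowerSeries (Polynomial ℂ), sv * iota0 (psi0 α) = sv ^ D1.natDegree * iotaI w2 ∧ IsAlgebraic (Polynomial ℂ) (PowerSeries.map Polynomial.constantCoeff w2) := by
    rcases Nat.eq_zero_or_pos D1.natDegree with h0 | h0
    · refine ⟨0, ?_, by rw [map_zero]; exact isAlgebraic_zero⟩
      have : α = 0 := by
        rw [Polynomial.degree_eq_natDegree hm.ne_zero, h0] at hα
        exact Polynomial.degree_eq_bot.1 (Nat.WithBot.lt_zero_iff.1 hα)
      simp [this]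
    · obtain ⟨j, hj⟩ := Nat.exists_eq_add_of_lt h0
      rw [zero_add] at hj
      have hle : α.natDegree ≤ j := by
        rw [Polynomial.natDegree_le_iff_degree_le]
        rw [Polynomial.degree_eq_natDegree hm.ne_zero, hj] at hα
        exact Order.le_of_lt_succ hα
      obtain ⟨w2, h1, h2, -⟩ := exists_inf α j hle
      refine ⟨w2, ?_, h2 ▸ halg j⟩
      rw [h1, hj]; ring
  have hUv : iota0 (psi0 U) * iota0 v = 1 := by rw [← map_mul, hv, map_one]
  have hwy : iotaI w1 * iotaI y1 = 1 := by rw [← map_mul, hy1, map_one]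
  have hF : twist f = iotaI (y1 * w2) + sv * iota0 (psi0 β * v) := by
    have hU0 : iota0 (psi0 U) ≠ 0 := left_ne_zero_of_mul_eq_one hUv
    have hD10 : iota0 (psi0 D1) ≠ 0 := by
      rw [hw1]
      exact mul_ne_zero (pow_ne_zero _ hsv0) (left_ne_zero_of_mul_eq_one hwy)
    apply mul_left_cancel₀ (mul_ne_zero hD10 hU0)
    have e1 : twist (qmap q) * twist f = twist (qmap p) := by rw [← map_mul, hf]
    have e2 : iota0 (psi0 D1) * iota0 (psi0 U) * twist f = sv * iota0 (psi0 N) := by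
      rw [← map_mul, ← map_mul, ← hDU, hD0, hN0, mul_assoc, e1]; ring
    rw [e2, hαβ]
    simp only [map_add, map_mul]
    rw [mul_add, hw1]
    linear_combination iota0 (psi0 U) * hw2 - (iota0 (psi0 U) * sv ^ D1.natDegree * iotaI w2) * hwy - (sv * iota0 (psi0 β) * sv ^ D1.natDegree * iotaI w1) * hUv
  have hy : PowerSeries.map Polynomial.constantCoeff y1 = 1 := by
    have := congrArg (PowerSeries.map Polynomial.constantCoeff) hy1
    rw [map_mul, hw1b, map_one, Polynomial.coeff_natDegree, hm, one_mul] at this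
    exact this
  rw [← cz_twist, hF, map_add, cz_pos, cz_inf, map_mul, hy, one_mul, add_zero]
  exact hw2a


theorem one_var_zero (c : ℕ → ℂ) (ε : ℝ) (hε : 0 < ε)
    (h : ∀ x : ℂ, ‖x‖ < ε → HasSum (fun n => c n * x ^ n) 0) : ∀ n, c n = 0 := by
  have h1 : HasFPowerSeriesAt (fun _ : ℂ => (0 : ℂ)) (FormalMultilinearSeries.ofScalars ℂ c) 0 := by
    rw [hasFPowerSeriesAt_iff]
    filter_upwards [Metric.ball_mem_nhds (0 : ℂ) hε] with z hz
    have := h z (by simpa using hz)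
    simpa [FormalMultilinearSeries.coeff_ofScalars, mul_comm] using this
  have h2 := h1.eq_zero
  intro n
  have := congrArg (fun p => FormalMultilinearSeries.coeff p n) h2
  simp only [FormalMultilinearSeries.coeff_ofScalars] at this
  rw [this]
  simp [FormalMultilinearSeries.coeff]

theorem two_var_zero (c : ℕ → ℕ → ℂ) (ε : ℝ) (hε : 0 < ε)
    (h : ∀ x y : ℂ, ‖x‖ < ε → ‖y‖ < ε →
      HasSum (fun mn : ℕ × ℕ => c mn.1 mn.2 * x ^ mn.1 * y ^ mn.2) 0) : ∀ m n, c m n = 0 := by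
  intro m
  apply one_var_zero _ ε hε
  intro y hy
  have hz : ∀ m, (∑' n, c m n * y ^ n) = 0 := by
    apply one_var_zero _ ε hε
    intro x hx
    have h1 := h x y hx hy
    have h2 := h1.prod_fiberwise (fun m => (h1.summable.prod_factor m).hasSum)
    convert h2 using 2 with m
    rw [← tsum_mul_right]
    refine tsum_congr fun n => ?_
    ring
  have hs : Summable (fun n => c m n * y ^ n) := by
    have hx0 : ((ε / 2 : ℝ) : ℂ) ≠ 0 := by exact_mod_cast (half_pos hε).ne'
    have h1 := (h ((ε / 2 : ℝ) : ℂ) y (by simp [abs_of_pos hε]; linarith) hy).summable.prod_factor m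
    have h2 := h1.mul_left ((((ε / 2 : ℝ) : ℂ) ^ m)⁻¹)
    refine h2.congr fun n => ?_
    field_simp
  rw [← hz m]
  exact hs.hasSum

def HS (x y : ℂ) (h : PowerSeries (PowerSeries ℂ)) (v : ℂ) : Prop :=
  HasSum (fun mn : ℕ × ℕ => PowerSeries.coeff mn.1 (PowerSeries.coeff mn.2 h) * x ^ mn.1 * y ^ mn.2) v

theorem HS.add {x y : ℂ} {h k : PowerSeries (PowerSeries ℂ)} {v w : ℂ} (hh : HS x y h v) (hk : HS x y k w) :
    HS x y (h + k) (v + w) := by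
  have := HasSum.add hh hk
  unfold HS
  convert this using 2 with mn
  simp only [map_add]
  ring

theorem HS.smul {x y : ℂ} {h : PowerSeries (PowerSeries ℂ)} {v : ℂ} (a : ℂ) (hh : HS x y h v) :
    HS x y (PowerSeries.C (PowerSeries.C a) * h) (a * v) := by
  have := HasSum.mul_left a hh
  simpa [HS, mul_assoc] using this

theorem HS.mulx {x y : ℂ} {h : PowerSeries (PowerSeries ℂ)} {v : ℂ} (hh : HS x y h v) :
    HS x y (PowerSeries.C PowerSeries.X * h) (x * v) := by
  have h1 := HasSum.mul_left x hh
  have hinj : Function.Injective (fun mn : ℕ × ℕ => (mn.1 + 1, mn.2)) := by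
    rintro ⟨a, b⟩ ⟨c, d⟩ h; simpa using h
  unfold HS
  rw [← hinj.hasSum_iff]
  · refine Eq.subst (motive := fun F => HasSum F _) (funext fun mn => ?_) h1
    simp only [Function.comp, PowerSeries.coeff_C_mul, PowerSeries.coeff_succ_X_mul]
    ring
  · rintro ⟨m, n⟩ hm
    rcases m with _ | m
    · simp
    · exact absurd ⟨(m, n), rfl⟩ hm

theorem HS.muly {x y : ℂ} {h : PowerSeries (PowerSeries ℂ)} {v : ℂ} (hh : HS x y h v) :
    HS x y (PowerSeries.X * h) (y * v) := by
  have h1 := HasSum.mul_left y hh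
  have hinj : Function.Injective (fun mn : ℕ × ℕ => (mn.1, mn.2 + 1)) := by
    rintro ⟨a, b⟩ ⟨c, d⟩ h; simpa using h
  unfold HS
  rw [← hinj.hasSum_iff]
  · refine Eq.subst (motive := fun F => HasSum F _) (funext fun mn => ?_) h1
    simp only [Function.comp, PowerSeries.coeff_C_mul, PowerSeries.coeff_succ_X_mul]
    ring
  · rintro ⟨m, n⟩ hm
    rcases n with _ | n
    · simp
    · exact absurd ⟨(m, n), rfl⟩ hm

theorem HS.qmap {x y : ℂ} (q : MvPolynomial (Fin 2) ℂ) : ∀ {h : PowerSeries (PowerSeries ℂ)} {v : ℂ}, HS x y h v →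
    HS x y (qmap q * h) (MvPolynomial.eval ![x, y] q * v) := by
  induction q using MvPolynomial.induction_on with
  | C a =>
    intro h v hh
    simpa [_root_.qmap] using hh.smul a
  | add p q hp hq =>
    intro h v hh
    simpa only [map_add, add_mul] using (hp hh).add (hq hh)
  | mul_X p i hp =>
    intro h v hh
    rw [map_mul, map_mul, mul_assoc, mul_assoc]
    apply hp
    fin_cases i
    · simpa [_root_.qmap] using hh.mulx
    · simpa [_root_.qmap] using hh.muly

theorem HS.one {x y : ℂ} : HS x y 1 1 := by
  unfold HS
  convert hasSum_single (f := fun mn : ℕ × ℕ => PowerSeries.coeff mn.1 (PowerSeries.coeff mn.2 (1 : PowerSeries (PowerSeries ℂ))) * x ^ mn.1 * y ^ mn.2) (0, 0) ?_ using 1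
  · simp
  · rintro ⟨m, n⟩ h
    simp only [PowerSeries.coeff_one]
    by_cases hn : n = 0
    · subst hn
      have : m ≠ 0 := by rintro rfl; exact h rfl
      simp [PowerSeries.coeff_one, this]
    · simp [hn]

def S1 (t : ℂ) (h : PowerSeries ℂ) (v : ℂ) : Prop :=
  Summable (fun n => ‖PowerSeries.coeff n h * t ^ n‖) ∧ ∑' n, PowerSeries.coeff n h * t ^ n = v

theorem S1.add {t : ℂ} {h k : PowerSeries ℂ} {v w : ℂ} (hh : S1 t h v) (hk : S1 t k w) : S1 t (h + k) (v + w) := by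
  have e : ∀ n, PowerSeries.coeff n (h + k) * t ^ n = PowerSeries.coeff n h * t ^ n + PowerSeries.coeff n k * t ^ n := by
    intro n; rw [map_add, add_mul]
  refine ⟨?_, ?_⟩
  · simp only [e]
    exact (hh.1.of_norm.add hk.1.of_norm).norm
  · simp only [e]
    rw [hh.1.of_norm.tsum_add hk.1.of_norm, hh.2, hk.2]

theorem S1.mul {t : ℂ} {h k : PowerSeries ℂ} {v w : ℂ} (hh : S1 t h v) (hk : S1 t k w) : S1 t (h * k) (v * w) := by
  have e : ∀ n, PowerSeries.coeff n (h * k) * t ^ n = ∑ ij ∈ Finset.HasAntidiagonal.antidiagonal n, (PowerSeries.coeff ij.1 h * t ^ ij.1) * (PowerSeries.coeff ij.2 k * t ^ ij.2) := by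
    intro n
    rw [PowerSeries.coeff_mul, Finset.sum_mul]
    refine Finset.sum_congr rfl fun ij hij => ?_
    rw [← Finset.HasAntidiagonal.mem_antidiagonal.1 hij, pow_add]; ring
  refine ⟨?_, ?_⟩
  · simp only [e]
    exact summable_norm_sum_mul_antidiagonal_of_summable_norm (f := fun n => PowerSeries.coeff n h * t ^ n) (g := fun n => PowerSeries.coeff n k * t ^ n) hh.1 hk.1
  · simp only [e]
    rw [← tsum_mul_tsum_eq_tsum_sum_antidiagonal_of_summable_norm (f := fun n => PowerSeries.coeff n h * t ^ n) (g := fun n => PowerSeries.coeff n k * t ^ n) hh.1 hk.1, hh.2, hk.2]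

theorem S1.poly (t : ℂ) (c : Polynomial ℂ) : S1 t (c : PowerSeries ℂ) (c.eval t) := by
  have hz : ∀ n ∉ Finset.range (c.natDegree + 1), PowerSeries.coeff n (c : PowerSeries ℂ) * t ^ n = 0 := by
    intro n hn
    rw [Polynomial.coeff_coe, Polynomial.coeff_eq_zero_of_natDegree_lt, zero_mul]
    have := mt Finset.mem_range.2 hn
    omega
  refine ⟨(summable_of_ne_finset_zero hz).norm, ?_⟩
  rw [tsum_eq_sum hz, Polynomial.eval_eq_sum_range]
  simp

theorem S1.aeval (t : ℂ) (g : PowerSeries ℂ) (v : ℂ) (hg : S1 t g v) (P : Polynomial (Polynomial ℂ)) :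
    S1 t (Polynomial.aeval g P) ((P.map (Polynomial.evalRingHom t)).eval v) := by
  have hC : ∀ c : Polynomial ℂ, S1 t (algebraMap (Polynomial ℂ) (PowerSeries ℂ) c) (c.eval t) := by
    intro c
    simpa [PowerSeries.algebraMap_apply'] using S1.poly t c
  induction P using Polynomial.induction_on with
  | C a => simpa using hC a
  | add p q hp hq => simpa only [map_add, Polynomial.map_add, Polynomial.eval_add] using hp.add hq
  | monomial n a ih =>
    have := ih.mul hg
    simpa [pow_succ, mul_assoc] using this

theorem main_diagonal_of_rational_is_algebraic (a : ℕ → ℕ → ℂ)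
    (ha : IsRationalBivariateSeries a) :
    IsAlgebraicFn (fun t => ∑' r : ℕ, a r r * t ^ r) := by
  obtain ⟨p, q, hq0, ε, hε, h⟩ := ha
  obtain ⟨δ, hδ, hq⟩ : ∃ δ > 0, ∀ x y : ℂ, ‖x‖ < δ → ‖y‖ < δ → MvPolynomial.eval ![x, y] q ≠ 0 := by
    have hc : Continuous (fun v : ℂ × ℂ => MvPolynomial.eval ![v.1, v.2] q) := by
      refine (MvPolynomial.continuous_eval q).comp ?_
      refine continuous_pi fun i => ?_
      fin_cases i
      · exact continuous_fst
      · exact continuous_snd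
    have h0 : MvPolynomial.eval ![(0 : ℂ × ℂ).1, (0 : ℂ × ℂ).2] q ≠ 0 := by
      convert hq0 using 3
      ext i; fin_cases i <;> simp
    obtain ⟨δ, hδ, hb⟩ := Metric.eventually_nhds_iff.1 (hc.continuousAt.eventually_ne h0)
    refine ⟨δ, hδ, fun x y hx hy => ?_⟩
    have := @hb (x, y) (by simp [hx, hy])
    exact this
  let f : PowerSeries (PowerSeries ℂ) := PowerSeries.mk fun n => PowerSeries.mk fun m => a m n
  have hf : qmap q * f = qmap p := by
    have hz := two_var_zero (fun m n => PowerSeries.coeff m (PowerSeries.coeff n (qmap q * f + PowerSeries.C (PowerSeries.C (-1)) * (qmap p * 1)))) (min ε δ) (lt_min hε hδ) (by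
      intro x y hx hy
      have h1 : HS x y f (MvPolynomial.eval ![x, y] p / MvPolynomial.eval ![x, y] q) := by
        have := h x y (hx.trans_le (min_le_left _ _)) (hy.trans_le (min_le_left _ _))
        simpa [HS, f] using this
      have h2 := (h1.qmap q).add ((HS.one.qmap p).smul (-1))
      rw [mul_div_cancel₀ _ (hq x y (hx.trans_le (min_le_right _ _)) (hy.trans_le (min_le_right _ _)))] at h2
      simpa [HS] using h2)
    rw [← sub_eq_zero]
    ext n m
    simpa [sub_eq_add_neg] using hz m n
  have hq1 : PowerSeries.constantCoeff (PowerSeries.constantCoeff (qmap q)) ≠ 0 := by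
    have : ((PowerSeries.constantCoeff (R := ℂ)).comp (PowerSeries.constantCoeff (R := PowerSeries ℂ))).comp qmap = MvPolynomial.eval (fun _ => (0 : ℂ)) := by
      apply MvPolynomial.ringHom_ext
      · intro r; simp [qmap]
      · intro i; fin_cases i <;> simp [qmap]
    have h2 := congrArg (fun r => r q) this
    simp only [RingHom.comp_apply] at h2
    rw [h2]; exact hq0
  obtain ⟨P, hP0, hP⟩ := formal_alg p q f hf hq1
  refine ⟨P, hP0, ε ^ 2, by positivity, fun t ht => ?_⟩
  obtain ⟨x, hx⟩ := IsAlgClosed.exists_pow_nat_eq t (n := 2) (by norm_num)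
  have hxε : ‖x‖ < ε := by
    rw [← hx, norm_pow] at ht
    exact lt_of_pow_lt_pow_left₀ 2 hε.le ht
  have hS : S1 t (PowerSeries.mk fun n => PowerSeries.coeff n (PowerSeries.coeff n f)) (∑' r : ℕ, a r r * t ^ r) := by
    refine ⟨?_, by simp [f]⟩
    have h1 := (h x x hxε hxε).summable
    have h2 := h1.comp_injective (i := fun r : ℕ => (r, r)) (fun a b h => by simpa using h)
    refine (h2.congr fun r => ?_).norm
    simp [f, ← hx, ← pow_mul, mul_assoc, ← pow_add, two_mul]
  have := (S1.aeval t _ _ hS P).2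
  rw [hP] at this
  simpa using this.symm
end

section
/- Let A_n = (∏_{i=1}^r (p_i n)!)/(∏_{j=1}^s (q_j n)!) with positive integers satisfying ∑p_i = ∑q_j, and let h(x) ∈ ℤ[x] be a nonzero polynomial. If the series u(z) = ∑_{n≥0} h(n) A_n z^n is a rational function of z, then r = s = 0 up to cancellation, i.e., A_n = 1 for all n, and hence ∑_{n≥0} A_n z^n = 1/(1−z). -/
open scoped Nat

lemma rfr_hasSum_mul (c : ℕ → ℂ) (z u : ℂ) (hu : HasSum (fun n => c n * z ^ n) u)
    (Q : Polynomial ℂ) :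
    HasSum (fun n => PowerSeries.coeff n ((Q : PowerSeries ℂ) * PowerSeries.mk c) * z ^ n)
      (Q.eval z * u) := by
  induction Q using Polynomial.induction_on' with
  | add p q hp hq =>
    have := hp.add hq
    simpa [add_mul] using this
  | monomial k a =>
    have h1 : HasSum (fun n => PowerSeries.coeff (n + k)
        (((Polynomial.monomial k a : Polynomial ℂ) : PowerSeries ℂ) * PowerSeries.mk c)
          * z ^ (n + k)) (a * z ^ k * u) := by
      refine (hu.mul_left (a * z ^ k)).congr_fun ?_ <;>
      · intro n
        rw [← Polynomial.C_mul_X_pow_eq_monomial, Polynomial.coe_mul, Polynomial.coe_pow,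
          Polynomial.coe_X, Polynomial.coe_C, mul_assoc, PowerSeries.coeff_C_mul,
          PowerSeries.coeff_X_pow_mul]
        simp; ring
    rw [Polynomial.eval_monomial]
    refine (hasSum_nat_add_iff' k).1 ?_
    rw [Finset.sum_eq_zero, sub_zero]
    · exact h1
    intro i hi
    rw [← Polynomial.C_mul_X_pow_eq_monomial, Polynomial.coe_mul, Polynomial.coe_pow,
          Polynomial.coe_X, Polynomial.coe_C, mul_assoc, PowerSeries.coeff_C_mul,
          PowerSeries.coeff_X_pow_mul', if_neg (by simpa using hi)]
    simp

lemma rfr_unique (c : ℕ → ℂ) (ε : ℝ) (hε : 0 < ε)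
    (h : ∀ z : ℂ, ‖z‖ < ε → HasSum (fun n => c n * z ^ n) 0) (n : ℕ) : c n = 0 := by
  have h1 : HasFPowerSeriesAt (0 : ℂ → ℂ) (FormalMultilinearSeries.ofScalars ℂ c) 0 := by
    rw [hasFPowerSeriesAt_iff]
    filter_upwards [Metric.ball_mem_nhds (0 : ℂ) hε] with z hz
    have := h z (by simpa using hz)
    simpa [FormalMultilinearSeries.coeff_ofScalars, mul_comm] using this
  have h2 := h1.eq_zero
  have h3 := FormalMultilinearSeries.coeff_ofScalars (p := c) (n := n)
  rw [h2] at h3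
  rw [← h3]; simp [FormalMultilinearSeries.coeff]

lemma rfr_formal (c : ℕ → ℂ) (P Q : Polynomial ℂ) (hQ0 : Q.eval 0 ≠ 0)
    (ε : ℝ) (hε : 0 < ε)
    (hrat : ∀ z : ℂ, ‖z‖ < ε → HasSum (fun n : ℕ => c n * z ^ n) (P.eval z / Q.eval z)) :
    (Q : PowerSeries ℂ) * PowerSeries.mk c = P := by
  have hc : ∀ᶠ z in nhds (0 : ℂ), Q.eval z ≠ 0 :=
    (Q.continuous.continuousAt (x := 0)).eventually_ne hQ0
  obtain ⟨δ, hδ, hδ'⟩ := Metric.eventually_nhds_iff.1 hc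
  ext n
  rw [← sub_eq_zero]
  refine rfr_unique (fun n => PowerSeries.coeff n ((Q : PowerSeries ℂ) * PowerSeries.mk c)
    - PowerSeries.coeff n (P : PowerSeries ℂ)) (min ε δ) (lt_min hε hδ) ?_ n
  intro z hz
  have hQz : Q.eval z ≠ 0 := hδ' (by simpa using lt_of_lt_of_le hz (min_le_right _ _))
  have h1 := rfr_hasSum_mul c z _ (hrat z (lt_of_lt_of_le hz (min_le_left _ _))) Q
  have h2 : HasSum (fun n => (if n = 0 then (1 : ℂ) else 0) * z ^ n) 1 := by
    convert hasSum_single (f := fun n => (if n = 0 then (1 : ℂ) else 0) * z ^ n) 0 ?_ using 1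
    · simp
    · intro b hb; simp [hb]
  have h3 := rfr_hasSum_mul _ z _ h2 P
  have h4 : (PowerSeries.mk fun n => if n = 0 then (1 : ℂ) else 0) = 1 := by
    ext n; simp [PowerSeries.coeff_one]
  rw [h4] at h3
  have h5 := h1.sub h3
  rw [mul_div_cancel₀ _ hQz] at h5
  simpa [sub_mul] using h5

/-- descent of the recurrence to rational coefficients -/
lemma rfr_descent (c : ℕ → ℚ) (P Q : Polynomial ℂ) (hQ0 : Q.eval 0 ≠ 0)
    (h : (Q : PowerSeries ℂ) * PowerSeries.mk (fun n => (c n : ℂ)) = P) :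
    ∃ (b : ℕ → ℚ) (d N : ℕ), b 0 ≠ 0 ∧ b d ≠ 0 ∧ d ≤ N ∧
      ∀ n, N ≤ n → ∑ k ∈ Finset.range (d + 1), b k * c (n - k) = 0 := by
  classical
  have hq : Q.coeff 0 ≠ 0 := by rwa [Polynomial.coeff_zero_eq_eval_zero]
  obtain ⟨ψ, hψ⟩ : ∃ ψ : Module.Dual ℚ ℂ, ψ (Q.coeff 0) ≠ 0 := by
    by_contra! hcon
    exact hq ((Module.forall_dual_apply_eq_zero_iff ℚ _).1 hcon)
  let b : ℕ → ℚ := fun k => ψ (Q.coeff k)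
  let d := Nat.findGreatest (fun k => b k ≠ 0) Q.natDegree
  have hd : b d ≠ 0 := Nat.findGreatest_spec (P := fun k => b k ≠ 0) (Nat.zero_le _) hψ
  have hgt : ∀ k, d < k → b k = 0 := by
    intro k hk
    by_cases hk' : k ≤ Q.natDegree
    · simpa using Nat.findGreatest_is_greatest hk hk'
    · simp [b, Polynomial.coeff_eq_zero_of_natDegree_lt (not_le.1 hk')]
  refine ⟨b, d, max d (P.natDegree + 1), hψ, hd, le_max_left _ _, ?_⟩
  intro n hn
  have h1 := congrArg (PowerSeries.coeff n) h
  rw [PowerSeries.coeff_mul, Polynomial.coeff_coe, Polynomial.coeff_eq_zero_of_natDegree_lt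
    (by have := le_max_right d (P.natDegree + 1); omega),
    Finset.Nat.sum_antidiagonal_eq_sum_range_succ_mk] at h1
  have h2 := congrArg ψ h1
  rw [map_sum, map_zero] at h2
  rw [← h2]
  rw [← Finset.sum_subset (s₁ := Finset.range (d + 1)) (s₂ := Finset.range n.succ)]
  · apply Finset.sum_congr rfl
    intro k hk
    simp only [Polynomial.coeff_coe, PowerSeries.coeff_mk]
    rw [show Q.coeff k * ((c (n - k) : ℚ) : ℂ) = (c (n - k)) • Q.coeff k by
      rw [Algebra.smul_def, mul_comm]; simp, map_smul, smul_eq_mul, mul_comm]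
  · have := le_max_left d (P.natDegree + 1)
    apply Finset.range_subset_range.2; omega
  · intro k _ hk
    have hk := hgt k (by rw [Finset.mem_range] at hk; omega)
    simp only [Polynomial.coeff_coe, PowerSeries.coeff_mk]
    rw [show Q.coeff k * ((c (n - k) : ℚ) : ℂ) = (c (n - k)) • Q.coeff k by
      rw [Algebra.smul_def, mul_comm]; simp, map_smul, smul_eq_mul]
    simp only [b] at hk
    rw [hk, mul_zero]

lemma rfr_norm_one (x : ℚ) (hx : x ≠ 0) :
    ∀ᶠ l : ℕ in Filter.atTop, l.Prime → padicNorm l x = 1 := by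
  filter_upwards [Filter.eventually_gt_atTop (max x.num.natAbs x.den)] with l hl hlp
  have : Fact l.Prime := ⟨hlp⟩
  have h1 : padicNorm l (x.num : ℚ) = 1 := by
    rw [padicNorm.int_eq_one_iff]
    intro hd
    have := Int.natAbs_dvd_natAbs.2 hd
    have := Nat.le_of_dvd (by simpa [Int.natAbs_pos] using hx) this
    have := le_max_left x.num.natAbs x.den
    simp at *; omega
  have h2 : padicNorm l (x.den : ℚ) = 1 := by
    rw [padicNorm.nat_eq_one_iff]
    intro hd
    have := Nat.le_of_dvd x.den_pos hd
    have := le_max_right x.num.natAbs x.den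
    omega
  rw [← Rat.num_div_den x, padicNorm.div, h1, h2, div_one]

lemma rfr_norm_le_one (x : ℚ) :
    ∀ᶠ l : ℕ in Filter.atTop, l.Prime → padicNorm l x ≤ 1 := by
  by_cases hx : x = 0
  · subst hx; simp
  · filter_upwards [rfr_norm_one x hx] with l hl hlp
    exact (hl hlp).le

lemma rfr_forward (l : ℕ) [Fact l.Prime] (b c : ℕ → ℚ) (d N : ℕ) (hdN : d ≤ N)
    (hb : ∀ k ∈ Finset.range (d + 1), padicNorm l (b k) ≤ 1) (hb0 : padicNorm l (b 0) = 1)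
    (hrec : ∀ n, N ≤ n → ∑ k ∈ Finset.range (d + 1), b k * c (n - k) = 0)
    (hc : ∀ n ∈ Finset.range N, padicNorm l (c n) ≤ 1) (n : ℕ) : padicNorm l (c n) ≤ 1 := by
  induction n using Nat.strong_induction_on with
  | _ n ih =>
    by_cases hn : n < N
    · exact hc n (by simpa using hn)
    · have h1 := hrec n (not_lt.1 hn)
      rw [Finset.sum_range_succ'] at h1
      have h2 : b 0 * c n = - ∑ k ∈ Finset.range d, b (k + 1) * c (n - (k + 1)) := by
        simp only [Nat.sub_zero] at h1; linarith
      have h3 : padicNorm l (c n) = padicNorm l (b 0 * c n) := by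
        rw [padicNorm.mul, hb0, one_mul]
      rw [h3, h2, padicNorm.neg]
      refine padicNorm.sum_le' ?_ zero_le_one
      intro k hk
      rw [Finset.mem_range] at hk
      rw [padicNorm.mul]
      exact mul_le_one₀ (hb _ (by simp; omega)) (padicNorm.nonneg _) (ih _ (by omega))

lemma rfr_backward (l : ℕ) [Fact l.Prime] (b c : ℕ → ℚ) (d N : ℕ) (hdN : d ≤ N)
    (hb : ∀ k ∈ Finset.range (d + 1), padicNorm l (b k) ≤ 1) (hbd : padicNorm l (b d) = 1)
    (hrec : ∀ n, N ≤ n → ∑ k ∈ Finset.range (d + 1), b k * c (n - k) = 0)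
    (M : ℕ) (hM : ∀ n, M ≤ n → n < M + d → padicNorm l (c n) < 1) (j n : ℕ)
    (hn : N ≤ n) (hj : M ≤ n + j) (hnM : n < M + d) : padicNorm l (c n) < 1 := by
  induction j using Nat.strong_induction_on generalizing n with
  | _ j ih =>
    by_cases hMn : M ≤ n
    · exact hM n hMn hnM
    · have h1 := hrec (n + d) (by omega)
      rw [Finset.sum_range_succ, Nat.add_sub_cancel] at h1
      have h2 : b d * c n = - ∑ k ∈ Finset.range d, b k * c (n + d - k) := by linarith
      have h3 : padicNorm l (c n) = padicNorm l (b d * c n) := by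
        rw [padicNorm.mul, hbd, one_mul]
      rw [h3, h2, padicNorm.neg]
      refine padicNorm.sum_lt' ?_ zero_lt_one
      intro k hk
      rw [Finset.mem_range] at hk
      rw [padicNorm.mul]
      have h4 : padicNorm l (c (n + d - k)) < 1 :=
        ih (j - 1) (by omega) _ (by omega) (by omega) (by omega)
      exact mul_lt_one_of_nonneg_of_lt_one_right (hb _ (by simp; omega)) (padicNorm.nonneg _) h4

lemma rfr_norm_prod (l : ℕ) [Fact l.Prime] {ι : Type*} (s : Finset ι) (f : ι → ℚ) :
    padicNorm l (∏ i ∈ s, f i) = ∏ i ∈ s, padicNorm l (f i) := by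
  classical
  induction s using Finset.induction_on with
  | empty => simp
  | insert a s ha ih => rw [Finset.prod_insert ha, Finset.prod_insert ha, padicNorm.mul, ih]

lemma rfr_prod_fiber {M : Type*} [CommMonoid M] (r B : ℕ) (p : Fin r → ℕ) (hB : ∀ i, p i < B)
    (F : ℕ → M) : ∏ i, F (p i) =
      ∏ a ∈ Finset.range B, F a ^ (Finset.univ.filter (fun i => p i = a)).card := by
  rw [← Finset.prod_fiberwise_of_maps_to' (s := Finset.univ) (t := Finset.range B) (g := p)
    (by intro i _; simpa using hB i) F]
  simp

lemma rfr_quot {M : Type*} [Field M] (r s : ℕ) (p : Fin r → ℕ) (q : Fin s → ℕ)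
    (F : ℕ → M) (hF : ∀ a, F a ≠ 0) (m : ℕ)
    (hm : ∀ a, m < a → (Finset.univ.filter (fun i => p i = a)).card =
      (Finset.univ.filter (fun i => q i = a)).card)
    (hlt : ∀ a, a < m → F a = 1) :
    (∏ i, F (p i)) / (∏ j, F (q j)) =
      F m ^ (Finset.univ.filter (fun i => p i = m)).card /
        F m ^ (Finset.univ.filter (fun i => q i = m)).card := by
  let B := ∑ i, p i + ∑ j, q j + m + 1
  have hp : ∀ i, p i < B := fun i => by
    have := Finset.single_le_sum (f := p) (fun _ _ => Nat.zero_le _) (Finset.mem_univ i)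
    simp only [B]; omega
  have hq : ∀ i, q i < B := fun i => by
    have := Finset.single_le_sum (f := q) (fun _ _ => Nat.zero_le _) (Finset.mem_univ i)
    simp only [B]; omega
  rw [rfr_prod_fiber r B p hp, rfr_prod_fiber s B q hq, ← Finset.prod_div_distrib]
  apply Finset.prod_eq_single m
  · intro a _ ha
    rcases lt_or_gt_of_ne ha with h | h
    · simp [hlt a h]
    · rw [hm a h, div_self (pow_ne_zero _ (hF a))]
  · intro h; exact absurd (Finset.mem_range.2 (by simp only [B]; omega)) h

lemma rfr_main
    (r s : ℕ) (p : Fin r → ℕ) (q : Fin s → ℕ)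
    (h : Polynomial ℤ) (hh : h ≠ 0)
    (A : ℕ → ℚ)
    (hA : ∀ n, A n = (∏ i, ((p i * n)! : ℚ)) / ∏ j, ((q j * n)! : ℚ))
    (b : ℕ → ℚ) (d N : ℕ) (hb0 : b 0 ≠ 0) (hbd : b d ≠ 0) (hdN : d ≤ N)
    (hrec : ∀ n, N ≤ n →
      ∑ k ∈ Finset.range (d + 1), b k * (((h.eval ((n - k : ℕ) : ℤ) : ℤ) : ℚ) * A (n - k)) = 0)
    (m : ℕ) (hm0 : 0 < m)
    (hm : ∀ a, m < a → (Finset.univ.filter (fun i => p i = a)).card =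
      (Finset.univ.filter (fun i => q i = a)).card)
    (hne : (Finset.univ.filter (fun i => p i = m)).card ≠
      (Finset.univ.filter (fun i => q i = m)).card) : False := by
  set c : ℕ → ℚ := fun n => ((h.eval (n : ℤ) : ℤ) : ℚ) * A n with hc
  -- a good point for h
  obtain ⟨n₀, hn₀N, hn₀⟩ : ∃ n₀ : ℕ, N ≤ n₀ ∧ h.eval (n₀ : ℤ) ≠ 0 := by
    by_contra! hcon
    apply hh
    apply Polynomial.eq_zero_of_infinite_isRoot
    refine Set.Infinite.mono (s := (fun n : ℕ => (n : ℤ)) '' Set.Ici N) ?_ ?_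
    · rintro _ ⟨n, hn, rfl⟩; exact hcon n hn
    · exact (Set.Ici_infinite N).image (Nat.cast_injective.injOn)
  set D := h.natDegree
  have hq1 : ((h.eval (n₀ : ℤ) : ℤ) : ℚ) ≠ 0 := by exact_mod_cast hn₀
  have hq2 : ((h.leadingCoeff : ℤ) : ℚ) ≠ 0 := by
    have := Polynomial.leadingCoeff_ne_zero.2 hh
    exact_mod_cast this
  have ev : ∀ᶠ l : ℕ in Filter.atTop, (l.Prime → padicNorm l (b 0) = 1) ∧
      (l.Prime → padicNorm l (b d) = 1) ∧
      (∀ k ∈ Finset.range (d + 1), l.Prime → padicNorm l (b k) ≤ 1) ∧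
      (∀ k ∈ Finset.range N, l.Prime → padicNorm l (c k) ≤ 1) ∧
      (l.Prime → padicNorm l ((h.eval (n₀ : ℤ) : ℤ) : ℚ) = 1) ∧
      (l.Prime → padicNorm l ((h.leadingCoeff : ℤ) : ℚ) = 1) ∧ m * n₀ < l ∧
      m ^ 2 * (d + D + 2) < l := by
    refine (rfr_norm_one _ hb0).and ((rfr_norm_one _ hbd).and (.and ?_ (.and ?_ ((rfr_norm_one _ hq1).and
      ((rfr_norm_one _ hq2).and
      ((Filter.eventually_gt_atTop _).and (Filter.eventually_gt_atTop _)))))))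
    · rw [Filter.eventually_all_finset]; intro k _; exact rfr_norm_le_one _
    · rw [Filter.eventually_all_finset]; intro k _; exact rfr_norm_le_one _
  obtain ⟨L, hL⟩ := Filter.eventually_atTop.1 ev
  obtain ⟨l, hlL, hlp⟩ := Nat.exists_infinite_primes L
  obtain ⟨e1, e2, e3, e4, e5, e6, e7, e8⟩ := hL l hlL
  have : Fact l.Prime := ⟨hlp⟩
  replace e1 := e1 hlp
  replace e2 := e2 hlp
  replace e3 := fun k hk => e3 k hk hlp
  replace e4 := fun k hk => e4 k hk hlp
  replace e5 := e5 hlp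
  replace e6 := e6 hlp
  have hint := rfr_forward l b c d N hdN e3 e1 hrec e4
  have hnA : ∀ n, (∀ a, a < m → a * n < l) → padicNorm l (A n) =
      padicNorm l ((m * n)! : ℚ) ^ (Finset.univ.filter (fun i => p i = m)).card /
      padicNorm l ((m * n)! : ℚ) ^ (Finset.univ.filter (fun i => q i = m)).card := by
    intro n hn
    rw [hA, padicNorm.div, rfr_norm_prod, rfr_norm_prod]
    refine rfr_quot r s p q (fun a => padicNorm l ((a * n)! : ℚ)) ?_ m hm ?_
    · intro a; exact padicNorm.nonzero (by exact_mod_cast Nat.factorial_ne_zero _)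
    · intro a ha
      rw [padicNorm.nat_eq_one_iff, hlp.dvd_factorial, not_le]
      exact hn a ha
  -- before the window
  have hA0 : padicNorm l (A n₀) = 1 := by
    rw [hnA n₀ (fun a ha => lt_of_le_of_lt (Nat.mul_le_mul_right _ ha.le) e7)]
    have : padicNorm l ((m * n₀)! : ℚ) = 1 := by
      rw [padicNorm.nat_eq_one_iff, hlp.dvd_factorial, not_le]; exact e7
    simp [this]
  set M := l / m + 1 with hM
  have hMl : l < m * M := by
    have := Nat.div_add_mod l m
    have := Nat.mod_lt l hm0
    rw [hM, mul_add]; omega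
  have hMu : m * M ≤ l + m := by
    have := Nat.mul_div_le l m
    rw [hM, mul_add]; omega
  have hwin1 : ∀ n, n < M + (d + D + 1) → ∀ a, a < m → a * n < l := by
    intro n hn a ha
    have h1 : a + 1 ≤ m := ha
    have h2 : m * n + m ≤ m * M + m * (d + D + 1) := by nlinarith
    have h3 : m * n ≤ l + m * (d + D + 1) := by omega
    by_contra! hcon
    have h4 : m * l ≤ a * (m * n) := by nlinarith
    have h5 : a * (m * n) ≤ a * (l + m * (d + D + 1)) := Nat.mul_le_mul_left _ h3
    have h6 : a * (m * (d + D + 1)) ≤ m * (m * (d + D + 1)) := Nat.mul_le_mul_right _ ha.le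
    have h7 : (a + 1) * l ≤ m * l := Nat.mul_le_mul_right _ h1
    nlinarith [Nat.zero_le (m^2)]
  have hwin2 : ∀ n, M ≤ n → padicNorm l ((m * n)! : ℚ) < 1 := by
    intro n hn
    rw [padicNorm.nat_lt_one_iff, hlp.dvd_factorial]
    exact hMl.le.trans (Nat.mul_le_mul_left _ hn)
  have hpos : ∀ n, 0 < padicNorm l ((m * n)! : ℚ) := fun n =>
    lt_of_le_of_ne (padicNorm.nonneg _)
      (padicNorm.nonzero (by exact_mod_cast Nat.factorial_ne_zero _)).symm
  rcases lt_or_gt_of_ne hne with hlt | hgt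
  · -- denominators
    have hroot : ∀ n, M ≤ n → n < M + (d + D + 1) → (l : ℤ) ∣ h.eval (n : ℤ) := by
      intro n hn1 hn2
      by_contra hnd
      have h1 := hint n
      simp only [hc] at h1
      rw [padicNorm.mul, (padicNorm.int_eq_one_iff _).2 hnd, one_mul, hnA n (hwin1 n hn2),
        div_le_one (pow_pos (hpos n) _)] at h1
      exact absurd h1 (not_le.2 (pow_lt_pow_right_of_lt_one₀ (hpos n) (hwin2 n hn1) hlt) ) 
    have hz : h.map (Int.castRingHom (ZMod l)) = 0 := by
      apply Polynomial.eq_zero_of_natDegree_lt_card_of_eval_eq_zero' _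
        ((Finset.Ico M (M + (D + 1))).image (fun n : ℕ => (n : ZMod l)))
      · intro x hx
        obtain ⟨n, hn, rfl⟩ := Finset.mem_image.1 hx
        rw [Finset.mem_Ico] at hn
        have h1 := hroot n hn.1 (by omega)
        have h2 := (ZMod.intCast_zmod_eq_zero_iff_dvd _ _).2 h1
        have h3 := Polynomial.eval_intCast_map (Int.castRingHom (ZMod l)) h (n : ℤ)
        simp only [Int.cast_natCast, eq_intCast] at h3
        rw [h3]; exact h2
      · rw [Finset.card_image_of_injOn]
        · have := Polynomial.natDegree_map_le (f := Int.castRingHom (ZMod l)) (p := h)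
          simp; omega
        · intro x hx y hy hxy
          simp only [Finset.coe_Ico, Set.mem_Ico] at hx hy
          have h1 : x ≡ y [MOD l] := (ZMod.natCast_eq_natCast_iff _ _ _).1 hxy
          have hl : D + 1 < l := by nlinarith [Nat.one_le_pow 2 m hm0]
          rcases le_total x y with hle | hle
          · have := (Nat.modEq_iff_dvd' hle).1 h1
            by_contra hxy'
            have := Nat.le_of_dvd (by omega) this
            omega
          · have := (Nat.modEq_iff_dvd' hle).1 h1.symm
            by_contra hxy'
            have := Nat.le_of_dvd (by omega) this
            omega
    have h1 := congrArg (fun f => Polynomial.coeff f D) hz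
    simp only [Polynomial.coeff_map, eq_intCast, Polynomial.coeff_zero] at h1
    have h2 := (ZMod.intCast_zmod_eq_zero_iff_dvd _ _).1 h1
    exact (padicNorm.int_eq_one_iff _).1 e6 h2
  · have hsmall : ∀ n, M ≤ n → n < M + d → padicNorm l (c n) < 1 := by
      intro n hn1 hn2
      simp only [hc]
      rw [padicNorm.mul, hnA n (hwin1 n (by omega))]
      refine mul_lt_one_of_nonneg_of_lt_one_right (padicNorm.of_int _)
        (div_nonneg (pow_nonneg (hpos n).le _) (pow_nonneg (hpos n).le _)) ?_
      rw [div_lt_one (pow_pos (hpos n) _)]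
      exact pow_lt_pow_right_of_lt_one₀ (hpos n) (hwin2 n hn1) hgt
    have hn0M : n₀ < M := by
      by_contra! hcon
      have := Nat.mul_le_mul_left m hcon
      omega
    have h1 := rfr_backward l b c d N hdN e3 e2 hrec M hsmall M n₀ hn₀N (by omega) (by omega)
    simp only [hc] at h1
    rw [padicNorm.mul, e5, hA0] at h1
    norm_num at h1

theorem rational_factorial_ratio_series_is_trivial
    (r s : ℕ) (p : Fin r → ℕ) (q : Fin s → ℕ)
    (hp : ∀ i, 0 < p i) (hq : ∀ j, 0 < q j)
    (hbal : ∑ i, p i = ∑ j, q j)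
    (h : Polynomial ℤ) (hh : h ≠ 0)
    (A : ℕ → ℚ)
    (hA : ∀ n, A n = (∏ i, ((p i * n)! : ℚ)) / ∏ j, ((q j * n)! : ℚ))
    (P Q : Polynomial ℂ) (hQ0 : Q.eval 0 ≠ 0)
    (ε : ℝ) (hε : 0 < ε)
    (hrat : ∀ z : ℂ, ‖z‖ < ε →
      HasSum (fun n : ℕ => ((h.eval (n : ℤ) : ℤ) : ℂ) * (A n : ℂ) * z ^ n)
        (P.eval z / Q.eval z)) :
    (∀ n, A n = 1) ∧
      ∀ z : ℂ, ‖z‖ < 1 →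
        HasSum (fun n : ℕ => (A n : ℂ) * z ^ n) (1 / (1 - z)) := by
  classical
  have key : ∀ n, A n = 1 := by
    by_cases hall : ∀ a, (Finset.univ.filter (fun i => p i = a)).card =
      (Finset.univ.filter (fun i => q i = a)).card
    · intro n
      rw [hA]
      have := rfr_quot r s p q (fun a => ((a * n)! : ℚ))
        (fun a => by exact_mod_cast Nat.factorial_ne_zero _) 0 (fun a _ => hall a)
        (fun a ha => absurd ha (Nat.not_lt_zero _))
      rw [this, hall 0, div_self]
      exact pow_ne_zero _ (by exact_mod_cast Nat.factorial_ne_zero _)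
    · exfalso
      have hform := rfr_formal (fun n => (((h.eval (n : ℤ) : ℤ) : ℚ) * A n : ℚ)) P Q hQ0 ε hε
        (by intro z hz; simpa using hrat z hz)
      obtain ⟨b, d, N, hb0, hbd, hdN, hrec⟩ := rfr_descent _ P Q hQ0 hform
      let pr : ℕ → Prop := fun a => (Finset.univ.filter (fun i => p i = a)).card ≠
        (Finset.univ.filter (fun i => q i = a)).card
      let B := ∑ i, p i + ∑ j, q j
      have hbig : ∀ a, B < a → ¬ pr a := by
        intro a ha
        simp only [pr, not_not]
        rw [Finset.card_eq_zero.2, Finset.card_eq_zero.2]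
        · rw [Finset.filter_eq_empty_iff]
          intro i _ hi
          have := Finset.single_le_sum (f := q) (fun _ _ => Nat.zero_le _) (Finset.mem_univ i)
          simp only [B] at ha; omega
        · rw [Finset.filter_eq_empty_iff]
          intro i _ hi
          have := Finset.single_le_sum (f := p) (fun _ _ => Nat.zero_le _) (Finset.mem_univ i)
          simp only [B] at ha; omega
      push Not at hall
      obtain ⟨a, ha⟩ := hall
      have haB : a ≤ B := by
        by_contra hcon
        exact hbig a (not_le.1 hcon) ha
      have hm1 : pr (Nat.findGreatest pr B) := Nat.findGreatest_spec haB ha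
      have hm2 : ∀ k, Nat.findGreatest pr B < k → ¬ pr k := by
        intro k hk
        by_cases hkB : k ≤ B
        · exact Nat.findGreatest_is_greatest hk hkB
        · exact hbig k (not_le.1 hkB)
      refine rfr_main r s p q h hh A hA b d N hb0 hbd hdN hrec (Nat.findGreatest pr B) ?_ ?_ hm1
      · rcases Nat.eq_zero_or_pos (Nat.findGreatest pr B) with h0 | h0
        · exfalso
          rw [h0] at hm1
          apply hm1
          rw [Finset.card_eq_zero.2, Finset.card_eq_zero.2]
          · rw [Finset.filter_eq_empty_iff]
            intro i _ hi
            have := hq i; omega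
          · rw [Finset.filter_eq_empty_iff]
            intro i _ hi
            have := hp i; omega
        · exact h0
      · intro k hk
        have := hm2 k hk
        simpa only [pr, not_not] using this
  refine ⟨key, ?_⟩
  intro z hz
  simpa [key] using hasSum_geometric_of_norm_lt_one hz
end
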